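/- arXiv:2601.09094 — 3 statements merged into one kernel-verified Lean document; each statement's English description precedes it below -/
import Mathlib

section
/- Let $k\in\mathbb{N}$, $s\in(0,1)$, and $p,q\in[1,\infty)$. Suppose there exist $\beta\in\mathbb{R}$ and $C>0$ such that for every $r>0$, every $A_1$-weight $\omega$, and every $f\in\dot{W}^{k,p}_\omega$, $\left(\int_{\mathbb{R}^n}\left(\int_{B(\mathbf{0},r)}\frac{|\Delta_h^k f(x)|^q}{|h|^{n+skq}}\,dh\right)^{p/q}\omega(x)\,dx\right)^{1/p}\le C\,[\omega]_{A_1}^{\beta}\,r^{(1-s)k}\,\||\nabla^k f|\|_{L^p_\omega}$. Then $\beta\ge 1/p$. -/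
open MeasureTheory Real Set
open scoped Classical ENNReal

noncomputable section

namespace Paper

variable {n : ℕ}

/-- The `k`-th order difference `Δ_h^k f (x)`. -/
def kdiff (k : ℕ) (f : EuclideanSpace ℝ (Fin n) → ℝ)
    (h x : EuclideanSpace ℝ (Fin n)) : ℝ :=
  ∑ j ∈ Finset.range (k + 1), (-1 : ℝ) ^ (k - j) * (k.choose j : ℝ) * f (x + j • h)

/-- Axis-parallel cubes. -/
def IsCube (Q : Set (EuclideanSpace ℝ (Fin n))) : Prop :=
  ∃ (a : EuclideanSpace ℝ (Fin n)) (l : ℝ), 0 < l ∧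
    Q = {x | ∀ i, x i ∈ Set.Ico (a i) (a i + l)}

/-- `ω` satisfies the `A₁` condition with constant `C`. -/
def MemA1 (ω : EuclideanSpace ℝ (Fin n) → ℝ) (C : ℝ) : Prop :=
  ∀ Q : Set (EuclideanSpace ℝ (Fin n)), IsCube Q →
    ∀ᵐ y ∂(volume.restrict Q), (⨍ x in Q, ω x) ≤ C * ω y

/-- `ω` satisfies the `A_p` condition (`p > 1`) with constant `C`. -/
def MemApGt (p : ℝ) (ω : EuclideanSpace ℝ (Fin n) → ℝ) (C : ℝ) : Prop :=
  ∀ Q : Set (EuclideanSpace ℝ (Fin n)), IsCube Q →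
    IntegrableOn (fun x => ω x ^ (-1 / (p - 1))) Q volume ∧
    (⨍ x in Q, ω x) * (⨍ x in Q, ω x ^ (-1 / (p - 1))) ^ (p - 1) ≤ C

/-- `A_p` condition for `p ∈ [1, ∞)`. -/
def MemAp (p : ℝ) (ω : EuclideanSpace ℝ (Fin n) → ℝ) (C : ℝ) : Prop :=
  if p = 1 then MemA1 ω C else MemApGt p ω C

/-- The Muckenhoupt constant `[ω]_{A_p}`. -/
def ApConst (p : ℝ) (ω : EuclideanSpace ℝ (Fin n) → ℝ) : ℝ :=
  sInf {C : ℝ | 0 ≤ C ∧ MemAp p ω C}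

/-- `ω ∈ A_p`: nonnegative, locally integrable, satisfying the `A_p` condition. -/
def IsAp (p : ℝ) (ω : EuclideanSpace ℝ (Fin n) → ℝ) : Prop :=
  (∀ x, 0 ≤ ω x) ∧ LocallyIntegrable ω volume ∧ ∃ C : ℝ, MemAp p ω C

/-- The `A₁` constant. -/
abbrev A1const (ω : EuclideanSpace ℝ (Fin n) → ℝ) : ℝ := ApConst 1 ω

/-- `ω ∈ A₁`. -/
abbrev IsA1 (ω : EuclideanSpace ℝ (Fin n) → ℝ) : Prop := IsAp 1 ω

/-- The critical exponent `p_ω := inf {r ∈ [1,∞) : ω ∈ A_r}`. -/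
def pExp (ω : EuclideanSpace ℝ (Fin n) → ℝ) : ℝ :=
  sInf {r : ℝ | 1 ≤ r ∧ IsAp r ω}

/-- Classical partial derivative in the `i`-th coordinate direction. -/
def pd (i : Fin n) (φ : EuclideanSpace ℝ (Fin n) → ℝ) :
    EuclideanSpace ℝ (Fin n) → ℝ :=
  fun x => fderiv ℝ φ x (EuclideanSpace.single i 1)

/-- The classical partial derivative `∂^α φ` for a multi-index `α`. -/
def pdMulti (α : Fin n → ℕ) (φ : EuclideanSpace ℝ (Fin n) → ℝ) :
    EuclideanSpace ℝ (Fin n) → ℝ :=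
  (List.finRange n).foldr (fun i ψ => (pd i)^[α i] ψ) φ

/-- `g` is the weak `α`-th partial derivative of `f`. -/
def HasWeakPD (α : Fin n → ℕ) (f g : EuclideanSpace ℝ (Fin n) → ℝ) : Prop :=
  ∀ φ : EuclideanSpace ℝ (Fin n) → ℝ, ContDiff ℝ (⊤ : ℕ∞) φ → HasCompactSupport φ →
    ∫ x, f x * pdMulti α φ x = (-1 : ℝ) ^ (∑ i, α i) * ∫ x, g x * φ x

/-- The multi-indices of order exactly `k`. -/
def multiIdx (n k : ℕ) : Finset (Fin n → ℕ) :=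
  ((Finset.univ : Finset (Fin n → Fin (k + 1))).image fun a i => (a i : ℕ)).filter
    fun α => ∑ i, α i = k

/-- The multi-indices of order at most `k`. -/
def multiIdxLE (n k : ℕ) : Finset (Fin n → ℕ) :=
  ((Finset.univ : Finset (Fin n → Fin (k + 1))).image fun a i => (a i : ℕ)).filter
    fun α => ∑ i, α i ≤ k

/-- `|∇^k f|` built from a family `g` of the `k`-th order (weak) partial derivatives. -/
def gradNorm (n k : ℕ) (g : (Fin n → ℕ) → EuclideanSpace ℝ (Fin n) → ℝ)
    (x : EuclideanSpace ℝ (Fin n)) : ℝ :=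
  Real.sqrt (∑ α ∈ multiIdx n k, g α x ^ 2)

end Paper

open Paper

lemma integrableOn_ball_norm_rpow {n : ℕ} (hn : 0 < n) {γ : ℝ} (hγ : 0 < γ) (R : ℝ) :
    IntegrableOn (fun x : EuclideanSpace ℝ (Fin n) => ‖x‖ ^ (γ - n)) (Metric.ball 0 R) := by
  have : Nonempty (Fin n) := ⟨⟨0, hn⟩⟩
  refine (integrableOn_fun_norm_addHaar (μ := volume) (f := fun y : ℝ => y ^ (γ - n))).2 ?_
  rcases le_or_gt R 0 with hR | hR
  · simp [Ioo_eq_empty_of_le hR]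
  have h := (intervalIntegral.intervalIntegrable_rpow' (a := 0) (b := R)
    (r := γ - 1) (by linarith)).1
  refine (h.mono_set Ioo_subset_Ioc_self).congr_fun (fun y hy => ?_) measurableSet_Ioo
  simp only [finrank_euclideanSpace, Fintype.card_fin, smul_eq_mul]
  rw [← rpow_natCast, ← rpow_add hy.1, Nat.cast_pred hn]
  congr 1
  ring

lemma setIntegral_ball_norm_rpow {n : ℕ} (hn : 0 < n) {γ : ℝ} (hγ : 0 < γ) {R : ℝ}
    (hR : 0 ≤ R) :
    ∫ x in Metric.ball (0 : EuclideanSpace ℝ (Fin n)) R, ‖x‖ ^ (γ - n) =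
      n * volume.real (Metric.ball (0 : EuclideanSpace ℝ (Fin n)) 1) * R ^ γ / γ := by
  have : Nonempty (Fin n) := ⟨⟨0, hn⟩⟩
  have h1 : ∫ x in Metric.ball (0 : EuclideanSpace ℝ (Fin n)) R, ‖x‖ ^ (γ - n) =
      ∫ x : EuclideanSpace ℝ (Fin n), (Iio R).indicator (fun y : ℝ => y ^ (γ - n)) ‖x‖ := by
    rw [← integral_indicator measurableSet_ball]
    congr 1
    ext x
    simp [indicator]
  have h2 : ∫ y in Ioi (0 : ℝ), y ^ (n - 1) • (Iio R).indicator (fun y : ℝ => y ^ (γ - n)) y =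
      R ^ γ / γ := by
    have h3 : ∀ y ∈ Ioi (0 : ℝ), y ^ (n - 1) • (Iio R).indicator (fun y : ℝ => y ^ (γ - n)) y =
        (Iio R).indicator (fun y : ℝ => y ^ (γ - 1)) y := by
      intro y hy
      by_cases hyR : y < R
      · simp only [indicator_of_mem (show y ∈ Iio R from hyR), smul_eq_mul]
        rw [← rpow_natCast, ← rpow_add hy, Nat.cast_pred hn]
        congr 1
        ring
      · simp [hyR]
    rw [setIntegral_congr_fun measurableSet_Ioi h3, setIntegral_indicator measurableSet_Iio,
      Ioi_inter_Iio, ← integral_Ioc_eq_integral_Ioo, ← intervalIntegral.integral_of_le hR,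
      integral_rpow (Or.inl (by linarith))]
    simp [hγ.ne']
  rw [h1, integral_fun_norm_addHaar volume, finrank_euclideanSpace, Fintype.card_fin, h2]
  simp only [smul_eq_mul, nsmul_eq_mul]
  ring

lemma kdiff_eq_fwdDiff {n : ℕ} (k : ℕ) (f : EuclideanSpace ℝ (Fin n) → ℝ)
    (h x : EuclideanSpace ℝ (Fin n)) :
    kdiff k f h x = (fwdDiff (1 : ℝ))^[k] (fun t : ℝ => f (x + t • h)) 0 := by
  rw [fwdDiff_iter_eq_sum_shift]
  refine Finset.sum_congr rfl fun j _ => ?_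
  simp [zsmul_eq_mul, Nat.cast_smul_eq_nsmul]

lemma abs_fwdDiff_iter_le (k : ℕ) {M : ℝ} (u : ℝ → ℝ) (hu : ContDiff ℝ k u)
    (hM : ∀ t, |iteratedDeriv k u t| ≤ M) (t : ℝ) : |(fwdDiff (1 : ℝ))^[k] u t| ≤ M := by
  induction k generalizing u t with
  | zero => simpa using hM t
  | succ k ih =>
    rw [Function.iterate_succ_apply]
    have hu' : ContDiff ℝ k u := hu.of_le (by exact_mod_cast Nat.le_succ k)
    have hs : ContDiff ℝ k (fun z => u (z + 1)) := hu'.comp (contDiff_id.add contDiff_const)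
    refine ih (fwdDiff 1 u) (hs.sub hu') (fun t => ?_) t
    have h1 : iteratedDeriv k (fwdDiff 1 u) t = iteratedDeriv k u (t + 1) - iteratedDeriv k u t := by
      have := iteratedDeriv_sub (x := t) hs.contDiffAt hu'.contDiffAt
      rw [iteratedDeriv_comp_add_const] at this
      exact this
    have hd : Differentiable ℝ (iteratedDeriv k u) :=
      hu.differentiable_iteratedDeriv k (by exact_mod_cast Nat.lt_succ_self k)
    have := Convex.norm_image_sub_le_of_norm_deriv_le (f := iteratedDeriv k u) (s := univ)
      (C := M) (x := t) (y := t + 1) (fun z _ => hd z)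
      (fun z _ => by rw [← iteratedDeriv_succ]; exact hM z) convex_univ trivial trivial
    rw [h1]
    simpa using this

lemma exists_abs_kdiff_le {n : ℕ} (k : ℕ) {f : EuclideanSpace ℝ (Fin n) → ℝ}
    (hf : ContDiff ℝ (⊤ : ℕ∞) f) (hc : HasCompactSupport f) :
    ∃ M, 0 ≤ M ∧ ∀ h x, |kdiff k f h x| ≤ M * ‖h‖ ^ k := by
  have hfk : ContDiff ℝ k f := hf.of_le (by exact_mod_cast le_top)
  obtain ⟨M, hM⟩ := (hf.continuous_iteratedFDeriv (m := k)
    (by exact_mod_cast le_top)).bounded_above_of_compact_support (hc.iteratedFDeriv k)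
  refine ⟨M, (norm_nonneg _).trans (hM 0), fun h x => ?_⟩
  rw [kdiff_eq_fwdDiff]
  let L : ℝ →L[ℝ] EuclideanSpace ℝ (Fin n) := ContinuousLinearMap.toSpanSingleton ℝ h
  have hL : (fun t : ℝ => f (x + t • h)) = (fun z => f (x + z)) ∘ L := by
    ext t; simp [L]
  have hfx : ContDiff ℝ k (fun z => f (x + z)) := hfk.comp (contDiff_const.add contDiff_id)
  refine abs_fwdDiff_iter_le k _ (by rw [hL]; exact hfx.comp L.contDiff) (fun t => ?_) 0
  rw [← Real.norm_eq_abs, ← norm_iteratedFDeriv_eq_norm_iteratedDeriv, hL,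
    L.iteratedFDeriv_comp_right hfx t le_rfl, iteratedFDeriv_comp_add_left]
  refine (ContinuousMultilinearMap.norm_compContinuousLinearMap_le _ _).trans ?_
  simp only [Finset.prod_const, Finset.card_univ, Fintype.card_fin]
  have : ‖L‖ = ‖h‖ := by simp [L]
  rw [this]
  gcongr
  exact hM _

lemma pd_contDiff {n : ℕ} (i : Fin n) {φ : EuclideanSpace ℝ (Fin n) → ℝ}
    (h : ContDiff ℝ (⊤ : ℕ∞) φ) : ContDiff ℝ (⊤ : ℕ∞) (pd i φ) :=
  (h.fderiv_right (m := (⊤ : ℕ∞)) (by exact_mod_cast le_top)).clm_apply contDiff_const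

lemma tsupport_pd_subset {n : ℕ} (i : Fin n) (φ : EuclideanSpace ℝ (Fin n) → ℝ) :
    tsupport (pd i φ) ⊆ tsupport φ := by
  exact tsupport_fderiv_apply_subset ℝ _

/-- Smooth functions with topological support in a compact set `K`. -/
def SmoothOn {n : ℕ} (K : Set (EuclideanSpace ℝ (Fin n))) (φ : EuclideanSpace ℝ (Fin n) → ℝ) :
    Prop :=
  ContDiff ℝ (⊤ : ℕ∞) φ ∧ tsupport φ ⊆ K

lemma SmoothOn.hasCompactSupport {n : ℕ} {K : Set (EuclideanSpace ℝ (Fin n))}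
    {φ : EuclideanSpace ℝ (Fin n) → ℝ} (h : SmoothOn K φ) (hK : IsCompact K) :
    HasCompactSupport φ :=
  hK.of_isClosed_subset (isClosed_tsupport φ) h.2

lemma SmoothOn.pd_iterate {n : ℕ} {K : Set (EuclideanSpace ℝ (Fin n))} (i : Fin n)
    {φ : EuclideanSpace ℝ (Fin n) → ℝ} (h : SmoothOn K φ) (a : ℕ) :
    SmoothOn K ((pd i)^[a] φ) := by
  induction a with
  | zero => exact h
  | succ a ih =>
    rw [Function.iterate_succ_apply']
    exact ⟨pd_contDiff i ih.1, (tsupport_pd_subset i _).trans ih.2⟩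

/-- Iterated partial derivatives, taken in the order adjoint to that of `pdMulti`. -/
def pdList {n : ℕ} (α : Fin n → ℕ) (l : List (Fin n)) (f : EuclideanSpace ℝ (Fin n) → ℝ) :
    EuclideanSpace ℝ (Fin n) → ℝ :=
  l.foldl (fun ψ i => (pd i)^[α i] ψ) f

lemma SmoothOn.pdList {n : ℕ} {K : Set (EuclideanSpace ℝ (Fin n))} (α : Fin n → ℕ)
    (l : List (Fin n)) {f : EuclideanSpace ℝ (Fin n) → ℝ} (h : SmoothOn K f) :
    SmoothOn K (pdList α l f) := by
  induction l generalizing f with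
  | nil => exact h
  | cons i l ih => exact ih (h.pd_iterate i (α i))

lemma SmoothOn.foldr {n : ℕ} {K : Set (EuclideanSpace ℝ (Fin n))} (α : Fin n → ℕ)
    (l : List (Fin n)) {φ : EuclideanSpace ℝ (Fin n) → ℝ} (h : SmoothOn K φ) :
    SmoothOn K (l.foldr (fun i ψ => (pd i)^[α i] ψ) φ) := by
  induction l with
  | nil => exact h
  | cons i l ih => exact ih.pd_iterate i (α i)

lemma integral_mul_pd {n : ℕ} {K K' : Set (EuclideanSpace ℝ (Fin n))} (hK : IsCompact K)
    (i : Fin n) {f φ : EuclideanSpace ℝ (Fin n) → ℝ} (hf : SmoothOn K f)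
    (hφ : SmoothOn K' φ) : ∫ x, f x * pd i φ x = - ∫ x, pd i f x * φ x := by
  have hf1 : SmoothOn K (pd i f) := hf.pd_iterate i 1
  have hφ1 : SmoothOn K' (pd i φ) := hφ.pd_iterate i 1
  have key : ∀ {u v : EuclideanSpace ℝ (Fin n) → ℝ}, SmoothOn K u → SmoothOn K' v →
      Integrable (fun x => u x * v x) := fun hu hv =>
    (hu.1.continuous.mul hv.1.continuous).integrable_of_hasCompactSupport
      (hu.hasCompactSupport hK).mul_right
  exact integral_mul_fderiv_eq_neg_fderiv_mul_of_integrable (key hf1 hφ) (key hf hφ1) (key hf hφ)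
    (fun x _ => hf.1.differentiable (by simp) x) (fun x _ => hφ.1.differentiable (by simp) x)

lemma integral_mul_pd_iterate {n : ℕ} {K K' : Set (EuclideanSpace ℝ (Fin n))} (hK : IsCompact K)
    (i : Fin n) (a : ℕ) {f φ : EuclideanSpace ℝ (Fin n) → ℝ}
    (hf : SmoothOn K f) (hφ : SmoothOn K' φ) :
    ∫ x, f x * (pd i)^[a] φ x = (-1) ^ a * ∫ x, (pd i)^[a] f x * φ x := by
  induction a generalizing f with
  | zero => simp
  | succ a ih =>
    rw [Function.iterate_succ_apply', integral_mul_pd hK i hf (hφ.pd_iterate i a),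
      ih (f := pd i f) (hf.pd_iterate i 1), pow_succ, Function.iterate_succ_apply]
    ring

lemma hasWeakPD_pdList {n : ℕ} {K : Set (EuclideanSpace ℝ (Fin n))} (hK : IsCompact K)
    (α : Fin n → ℕ) {f : EuclideanSpace ℝ (Fin n) → ℝ} (hf : SmoothOn K f) :
    HasWeakPD α f (pdList α (List.finRange n) f) := by
  intro φ hφ hc
  have hφ' : SmoothOn (tsupport φ) φ := ⟨hφ, Subset.rfl⟩
  have key : ∀ (l : List (Fin n)) (f : EuclideanSpace ℝ (Fin n) → ℝ), SmoothOn K f →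
      ∫ x, f x * l.foldr (fun i ψ => (pd i)^[α i] ψ) φ x =
        (-1) ^ (l.map α).sum * ∫ x, pdList α l f x * φ x := by
    intro l
    induction l with
    | nil => intro f _; simp [pdList]
    | cons i l ih =>
      intro f hf
      rw [List.foldr_cons, integral_mul_pd_iterate hK i (α i) hf (hφ'.foldr α l),
        ih _ (hf.pd_iterate i (α i)), List.map_cons, List.sum_cons, pow_add, mul_assoc]
      rfl
  have := key (List.finRange n) f hf
  rw [show ((List.finRange n).map α).sum = ∑ i, α i by
    rw [← List.ofFn_eq_map, List.sum_ofFn]] at this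
  exact this

lemma measurableSet_of_isCube {n : ℕ} {Q : Set (EuclideanSpace ℝ (Fin n))} (hQ : IsCube Q) :
    MeasurableSet Q := by
  obtain ⟨a, l, -, rfl⟩ := hQ
  simp only [ofPred_forall]
  exact MeasurableSet.iInter fun i =>
    measurableSet_Ico.preimage (EuclideanSpace.proj i).continuous.measurable

lemma volume_cube {n : ℕ} (a : EuclideanSpace ℝ (Fin n)) {l : ℝ} (hl : 0 < l) :
    volume {x : EuclideanSpace ℝ (Fin n) | ∀ i, x i ∈ Ico (a i) (a i + l)} =
      ENNReal.ofReal (l ^ n) := by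
  have h : {x : EuclideanSpace ℝ (Fin n) | ∀ i, x i ∈ Ico (a i) (a i + l)} =
      WithLp.ofLp ⁻¹' (univ.pi fun i => Ico (a i) (a i + l)) := by
    ext x; simp
  rw [h, (PiLp.volume_preserving_ofLp (Fin n)).measure_preimage
    (MeasurableSet.univ_pi fun i => measurableSet_Ico).nullMeasurableSet, Real.volume_pi_Ico]
  simp [ENNReal.ofReal_pow hl.le]

lemma norm_sub_le_of_mem_cube {n : ℕ} {a x y : EuclideanSpace ℝ (Fin n)} {l : ℝ} (hl : 0 < l)
    (hx : ∀ i, x i ∈ Ico (a i) (a i + l)) (hy : ∀ i, y i ∈ Ico (a i) (a i + l)) :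
    ‖x - y‖ ≤ √n * l := by
  rw [EuclideanSpace.norm_eq, ← Real.sqrt_sq hl.le, ← Real.sqrt_mul (Nat.cast_nonneg n)]
  refine Real.sqrt_le_sqrt ?_
  calc ∑ i, ‖(x - y) i‖ ^ 2 ≤ ∑ _i : Fin n, l ^ 2 := by
        refine Finset.sum_le_sum fun i _ => ?_
        rw [Real.norm_eq_abs]
        refine pow_le_pow_left₀ (abs_nonneg _) ?_ 2
        have h1 := hx i
        have h2 := hy i
        simp only [PiLp.sub_apply, mem_Ico] at *
        rw [abs_le]
        constructor <;> linarith
    _ = n * l ^ 2 := by simp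

lemma locallyIntegrable_norm_rpow {n : ℕ} (hn : 0 < n) {δ : ℝ} (hδ : 0 < δ) :
    LocallyIntegrable (fun x : EuclideanSpace ℝ (Fin n) => ‖x‖ ^ (δ - n)) := fun x =>
  ⟨Metric.ball 0 (‖x‖ + 1), Metric.isOpen_ball.mem_nhds (by simp),
    integrableOn_ball_norm_rpow hn hδ _⟩

lemma exists_memAp_one_norm_rpow {n : ℕ} (hn : 0 < n) :
    ∃ K : ℝ, 0 < K ∧ ∀ δ : ℝ, 0 < δ → δ ≤ 1 →
      MemAp 1 (fun x : EuclideanSpace ℝ (Fin n) => ‖x‖ ^ (δ - n)) (K / δ) := by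
  have : Nonempty (Fin n) := ⟨⟨0, hn⟩⟩
  set v := volume.real (Metric.ball (0 : EuclideanSpace ℝ (Fin n)) 1) with hv
  have hv0 : 0 ≤ v := measureReal_nonneg
  have hn1 : (1 : ℝ) ≤ n := by exact_mod_cast hn
  have hD : 0 < √(n : ℝ) := Real.sqrt_pos.2 (by linarith)
  refine ⟨n * v * (3 * √n) ^ n + 2 ^ n, by positivity, fun δ hδ hδ1 => ?_⟩
  rw [MemAp, if_pos rfl]
  intro Q hQ
  have hQm := measurableSet_of_isCube hQ
  obtain ⟨a, l, hl, hQe⟩ := hQ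
  have hvol : volume Q = ENNReal.ofReal (l ^ n) := by rw [hQe]; exact volume_cube a hl
  have hvolr : volume.real Q = l ^ n := by
    rw [measureReal_def, hvol, ENNReal.toReal_ofReal (by positivity)]
  have hdiam : ∀ x ∈ Q, ∀ y ∈ Q, ‖x - y‖ ≤ √n * l := by
    rw [hQe]; exact fun x hx y hy => norm_sub_le_of_mem_cube hl hx hy
  have h0 : ∀ᵐ y : EuclideanSpace ℝ (Fin n), y ≠ 0 := Measure.ae_ne volume 0
  filter_upwards [ae_restrict_mem hQm, ae_restrict_of_ae h0] with y hy hy0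
  have hy0' : 0 < ‖y‖ := norm_pos_iff.2 hy0
  rw [setAverage_eq, hvolr, smul_eq_mul, inv_mul_le_iff₀ (by positivity)]
  by_cases hc : ∃ y0 ∈ Q, ‖y0‖ < 2 * (√n * l)
  · obtain ⟨y0, hy0Q, hy0l⟩ := hc
    set R := 3 * √n * l with hR
    have hR0 : 0 < R := by positivity
    have hsub : Q ⊆ Metric.ball 0 R := fun x hx => by
      rw [mem_ball_zero_iff]
      have := hdiam x hx y0 hy0Q
      have := norm_le_norm_add_norm_sub y0 x
      rw [norm_sub_rev] at this
      linarith
    have h1 := setIntegral_mono_set (integrableOn_ball_norm_rpow hn hδ R)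
      (Filter.Eventually.of_forall fun x => rpow_nonneg (norm_nonneg x) _)
      hsub.eventuallyLE
    rw [setIntegral_ball_norm_rpow hn hδ hR0.le, ← hv] at h1
    refine h1.trans ?_
    have h2 : R ^ (δ - n) ≤ ‖y‖ ^ (δ - n) :=
      rpow_le_rpow_of_nonpos hy0' (mem_ball_zero_iff.1 (hsub hy)).le (by linarith)
    have h3 : R ^ δ = R ^ (δ - n) * ((3 * √n) ^ n * l ^ n) := by
      rw [← mul_pow, ← hR, ← rpow_natCast, ← rpow_add hR0, sub_add_cancel]
    calc n * v * R ^ δ / δ = l ^ n * (n * v * (3 * √n) ^ n / δ * R ^ (δ - n)) := by rw [h3]; ring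
      _ ≤ l ^ n * (((n * v * (3 * √n) ^ n + 2 ^ n) / δ) * ‖y‖ ^ (δ - n)) := by
        gcongr
        exact le_add_of_nonneg_right (by positivity)
  · push Not at hc
    have h1 : ∀ x ∈ Q, ‖x‖ ^ (δ - n) ≤ 2 ^ n * ‖y‖ ^ (δ - n) := fun x hx => by
      have h2 : ‖y‖ / 2 ≤ ‖x‖ := by
        have := hdiam x hx y hy
        have := norm_le_norm_add_norm_sub x y
        have := hc x hx
        linarith
      calc ‖x‖ ^ (δ - n) ≤ (‖y‖ / 2) ^ (δ - n) :=
            rpow_le_rpow_of_nonpos (by positivity) h2 (by linarith)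
        _ = 2 ^ (n - δ) * ‖y‖ ^ (δ - n) := by
            rw [div_rpow hy0'.le (by norm_num), div_eq_mul_inv, ← rpow_neg (by norm_num), neg_sub,
              mul_comm]
        _ ≤ 2 ^ n * ‖y‖ ^ (δ - n) := by
            gcongr
            rw [← rpow_natCast]
            exact rpow_le_rpow_of_exponent_le (by norm_num) (by linarith)
    have h2 : ∫ x in Q, ‖x‖ ^ (δ - n) ≤ ∫ _x in Q, (2 ^ n * ‖y‖ ^ (δ - n) : ℝ) :=
      integral_mono_of_nonneg (Filter.Eventually.of_forall fun x => rpow_nonneg (norm_nonneg x) _)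
        (integrableOn_const (by rw [hvol]; exact ENNReal.ofReal_ne_top))
        ((ae_restrict_iff' hQm).2 (Filter.Eventually.of_forall h1))
    rw [setIntegral_const, hvolr, smul_eq_mul] at h2
    refine h2.trans ?_
    gcongr
    rw [le_div_iff₀ hδ]
    calc (2 : ℝ) ^ n * δ ≤ 2 ^ n * 1 := by gcongr
      _ ≤ _ := by rw [mul_one]; exact le_add_of_nonneg_left (by positivity)

lemma one_le_of_memAp_one_norm_rpow {n : ℕ} (hn : 0 < n) {δ : ℝ} (hδ : 0 < δ) {C : ℝ}
    (h : MemAp 1 (fun x : EuclideanSpace ℝ (Fin n) => ‖x‖ ^ (δ - n)) C) : 1 ≤ C := by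
  have : Nonempty (Fin n) := ⟨⟨0, hn⟩⟩
  rw [MemAp, if_pos rfl] at h
  set Q : Set (EuclideanSpace ℝ (Fin n)) :=
    {x | ∀ i, x i ∈ Ico ((0 : EuclideanSpace ℝ (Fin n)) i)
      ((0 : EuclideanSpace ℝ (Fin n)) i + 1)} with hQdef
  have hQ : IsCube Q := ⟨0, 1, one_pos, rfl⟩
  have hvol : volume Q = 1 := by rw [hQdef, volume_cube 0 one_pos]; simp
  have hsub : Q ⊆ Metric.ball 0 (√n + 1) := fun x hx => by
    have := norm_sub_le_of_mem_cube (a := 0) (y := 0) one_pos hx (by simp)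
    rw [mem_ball_zero_iff]
    rw [sub_zero, mul_one] at this
    linarith
  have hint := (integrableOn_ball_norm_rpow hn hδ (√n + 1)).mono_set hsub
  have hpos : 0 < ∫ x in Q, ‖x‖ ^ (δ - n) := by
    rw [setIntegral_pos_iff_support_of_nonneg_ae
      (Filter.Eventually.of_forall fun x => rpow_nonneg (norm_nonneg x) _) hint]
    have : Q \ {0} ⊆ Function.support (fun x => ‖x‖ ^ (δ - n)) ∩ Q := fun x hx =>
      ⟨(rpow_pos_of_pos (norm_pos_iff.2 hx.2) _).ne', hx.1⟩
    refine lt_of_lt_of_le ?_ (measure_mono this)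
    rw [measure_sdiff_null (measure_singleton 0), hvol]
    exact one_pos
  have h1 := h Q hQ
  rw [setAverage_eq, measureReal_def, hvol] at h1
  simp only [ENNReal.toReal_one, inv_one, one_smul] at h1
  have h2 := setIntegral_mono_ae_restrict
    (integrableOn_const (by rw [hvol]; exact ENNReal.one_ne_top))
    (hint.const_mul C) h1
  rw [setIntegral_const, measureReal_def, hvol, integral_const_mul] at h2
  simp only [ENNReal.toReal_one, one_smul] at h2
  exact le_of_mul_le_mul_right (by simpa using h2) hpos

lemma isA1_norm_rpow {n : ℕ} (hn : 0 < n) {δ : ℝ} (hδ : 0 < δ) (hδ1 : δ ≤ 1) :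
    IsA1 (fun x : EuclideanSpace ℝ (Fin n) => ‖x‖ ^ (δ - n)) := by
  obtain ⟨K, -, h⟩ := exists_memAp_one_norm_rpow hn
  exact ⟨fun x => rpow_nonneg (norm_nonneg x) _, locallyIntegrable_norm_rpow hn hδ,
    _, h δ hδ hδ1⟩

lemma exists_A1const_norm_rpow_bounds {n : ℕ} (hn : 0 < n) :
    ∃ K : ℝ, 0 < K ∧ ∀ δ : ℝ, 0 < δ → δ ≤ 1 →
      1 ≤ A1const (fun x : EuclideanSpace ℝ (Fin n) => ‖x‖ ^ (δ - n)) ∧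
      A1const (fun x : EuclideanSpace ℝ (Fin n) => ‖x‖ ^ (δ - n)) ≤ K / δ := by
  obtain ⟨K, hK, h⟩ := exists_memAp_one_norm_rpow hn
  refine ⟨K, hK, fun δ hδ hδ1 => ?_⟩
  have hmem : K / δ ∈ {C : ℝ | 0 ≤ C ∧
      MemAp 1 (fun x : EuclideanSpace ℝ (Fin n) => ‖x‖ ^ (δ - n)) C} :=
    ⟨by positivity, h δ hδ hδ1⟩
  exact ⟨le_csInf ⟨_, hmem⟩ fun C hC => one_le_of_memAp_one_norm_rpow hn hδ hC.2,
    csInf_le ⟨0, fun C hC => hC.1⟩ hmem⟩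

/-- The inner integral `∫_{B(0,r)} |Δ_h^k f(x)|^q |h|^{-n-skq} dh`. -/
def diffIntegral {n : ℕ} (k : ℕ) (s q r : ℝ) (f : EuclideanSpace ℝ (Fin n) → ℝ)
    (x : EuclideanSpace ℝ (Fin n)) : ℝ :=
  ∫ h in Metric.ball (0 : EuclideanSpace ℝ (Fin n)) r,
    |kdiff k f h x| ^ q / ‖h‖ ^ ((n : ℝ) + s * k * q)

lemma measurable_kdiff_div {n : ℕ} (k : ℕ) (s q : ℝ) {f : EuclideanSpace ℝ (Fin n) → ℝ}
    (hf : Continuous f) :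
    Measurable (fun z : EuclideanSpace ℝ (Fin n) × EuclideanSpace ℝ (Fin n) =>
      |kdiff k f z.2 z.1| ^ q / ‖z.2‖ ^ ((n : ℝ) + s * k * q)) := by
  have h1 : Continuous (fun z : EuclideanSpace ℝ (Fin n) × EuclideanSpace ℝ (Fin n) =>
      kdiff k f z.2 z.1) := by
    unfold kdiff
    fun_prop
  exact (h1.measurable.abs.pow_const q).div (measurable_snd.norm.pow_const _)

lemma measurable_diffIntegral {n : ℕ} (k : ℕ) (s q r : ℝ) {f : EuclideanSpace ℝ (Fin n) → ℝ}
    (hf : Continuous f) : Measurable (diffIntegral k s q r f) :=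
  (measurable_kdiff_div k s q hf).stronglyMeasurable.integral_prod_right.measurable

lemma diffIntegral_nonneg {n : ℕ} (k : ℕ) (s q r : ℝ) (f : EuclideanSpace ℝ (Fin n) → ℝ)
    (x : EuclideanSpace ℝ (Fin n)) : 0 ≤ diffIntegral k s q r f x :=
  integral_nonneg fun _ => by positivity

lemma exists_diffIntegral_le {n k : ℕ} (hn : 0 < n) (hk : 0 < k) {s q : ℝ} (hs0 : 0 < s)
    (hs1 : s < 1) (hq : 0 < q) (r : ℝ) {f : EuclideanSpace ℝ (Fin n) → ℝ}
    (hf : ContDiff ℝ (⊤ : ℕ∞) f) (hc : HasCompactSupport f) :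
    ∃ B, 0 ≤ B ∧ ∀ x, diffIntegral k s q r f x ≤ B ∧
      IntegrableOn (fun h => |kdiff k f h x| ^ q / ‖h‖ ^ ((n : ℝ) + s * k * q))
        (Metric.ball 0 r) := by
  obtain ⟨M, hM, hbd⟩ := exists_abs_kdiff_le k hf hc
  have hk' : (0 : ℝ) < k := by exact_mod_cast hk
  have hγ : 0 < (1 - s) * k * q := by
    have : 0 < 1 - s := by linarith
    positivity
  have hint := (integrableOn_ball_norm_rpow hn hγ r).const_mul (M ^ q)
  have hle : ∀ x h : EuclideanSpace ℝ (Fin n),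
      |kdiff k f h x| ^ q / ‖h‖ ^ ((n : ℝ) + s * k * q) ≤
        M ^ q * ‖h‖ ^ ((1 - s) * k * q - n) := by
    intro x h
    rcases eq_or_ne h 0 with rfl | hh
    · rw [norm_zero, zero_rpow (by positivity), div_zero]
      positivity
    have hh' : 0 < ‖h‖ := norm_pos_iff.2 hh
    rw [div_le_iff₀ (by positivity), mul_assoc, ← rpow_add hh']
    calc |kdiff k f h x| ^ q ≤ (M * ‖h‖ ^ k) ^ q :=
          rpow_le_rpow (abs_nonneg _) (hbd h x) hq.le
      _ = M ^ q * ‖h‖ ^ ((k : ℝ) * q) := by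
          rw [mul_rpow hM (by positivity), ← rpow_natCast, ← rpow_mul hh'.le]
      _ = _ := by congr 2; ring
  refine ⟨∫ h in Metric.ball (0 : EuclideanSpace ℝ (Fin n)) r,
    M ^ q * ‖h‖ ^ ((1 - s) * k * q - n), integral_nonneg fun h => by positivity, fun x => ?_⟩
  have hI : IntegrableOn (fun h => |kdiff k f h x| ^ q / ‖h‖ ^ ((n : ℝ) + s * k * q))
      (Metric.ball 0 r) := by
    refine Integrable.mono' hint
      ((measurable_kdiff_div k s q hf.continuous).comp
        measurable_prodMk_left).aestronglyMeasurable
      (Filter.Eventually.of_forall fun h => ?_)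
    rw [Real.norm_of_nonneg (by positivity)]
    exact hle x h
  exact ⟨setIntegral_mono hI hint (hle x), hI⟩

lemma diffIntegral_eq_zero {n : ℕ} (k : ℕ) (s : ℝ) {q r ρ : ℝ} (hq : 0 < q)
    {f : EuclideanSpace ℝ (Fin n) → ℝ} (hf : ∀ x, ρ < ‖x‖ → f x = 0)
    {x : EuclideanSpace ℝ (Fin n)} (hx : ρ + k * r ≤ ‖x‖) (hk : 0 < k) :
    diffIntegral k s q r f x = 0 := by
  refine setIntegral_eq_zero_of_forall_eq_zero fun h hh => ?_
  have h0 : kdiff k f h x = 0 := by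
    refine Finset.sum_eq_zero fun j hj => ?_
    have hj' : (j : ℝ) ≤ k := by exact_mod_cast Nat.lt_succ_iff.1 (Finset.mem_range.1 hj)
    have hk' : (0 : ℝ) < k := by exact_mod_cast hk
    rw [hf, mul_zero]
    have h1 : ‖j • h‖ ≤ j * ‖h‖ := norm_nsmul_le
    have h2 : j * ‖h‖ ≤ k * ‖h‖ := by gcongr
    have h3 : k * ‖h‖ < k * r := by
      have := mem_ball_zero_iff.1 hh
      gcongr
    have h4 : ‖x‖ ≤ ‖x + j • h‖ + ‖j • h‖ := by
      simpa using norm_sub_le (x + j • h) (j • h)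
    linarith
  simp [h0, zero_rpow hq.ne']

lemma exists_integral_rpow_mul_le {n : ℕ} {S : Set (EuclideanSpace ℝ (Fin n))} (hS : IsCompact S)
    (hS' : ∀ x ∈ S, 1 / 2 ≤ ‖x‖) {u : EuclideanSpace ℝ (Fin n) → ℝ} (hu : Continuous u)
    (hu0 : ∀ x ∉ S, u x = 0) (hn : 0 < n) {p : ℝ} (hp : 0 < p) :
    ∃ M, 0 ≤ M ∧ ∀ δ : ℝ, 0 < δ → δ ≤ 1 →
      Integrable (fun x => |u x| ^ p * ‖x‖ ^ (δ - n)) ∧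
      ∫ x, |u x| ^ p * ‖x‖ ^ (δ - n) ≤ M := by
  obtain ⟨M, hM⟩ := hS.exists_bound_of_continuousOn hu.continuousOn
  have hn1 : (1 : ℝ) ≤ n := by exact_mod_cast hn
  have hle : ∀ δ : ℝ, 0 < δ → δ ≤ 1 → ∀ x, |u x| ^ p * ‖x‖ ^ (δ - n) ≤
      S.indicator (fun _ => |M| ^ p * 2 ^ n) x := by
    intro δ hδ hδ1 x
    by_cases hx : x ∈ S
    · rw [indicator_of_mem hx]
      have h1 : |u x| ≤ |M| := (hM x hx).trans (le_abs_self M)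
      have h2 : ‖x‖ ^ (δ - n) ≤ 2 ^ n := by
        calc ‖x‖ ^ (δ - n) ≤ (1 / 2) ^ (δ - n) :=
              rpow_le_rpow_of_nonpos (by norm_num) (hS' x hx) (by linarith)
          _ = 2 ^ (n - δ) := by
              rw [one_div, inv_rpow (by norm_num), ← rpow_neg (by norm_num), neg_sub]
          _ ≤ 2 ^ (n : ℝ) := rpow_le_rpow_of_exponent_le (by norm_num) (by linarith)
          _ = 2 ^ n := rpow_natCast _ _
      gcongr
    · rw [indicator_of_notMem hx, hu0 x hx, abs_zero, zero_rpow hp.ne', zero_mul]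
  have hI : Integrable (S.indicator fun _ : EuclideanSpace ℝ (Fin n) => |M| ^ p * 2 ^ n) := by
    rw [integrable_indicator_iff hS.isClosed.measurableSet]
    exact integrableOn_const hS.measure_lt_top.ne
  refine ⟨∫ x, S.indicator (fun _ : EuclideanSpace ℝ (Fin n) => |M| ^ p * 2 ^ n) x,
    integral_nonneg fun x => indicator_nonneg (fun _ _ => by positivity) x, fun δ hδ hδ1 => ?_⟩
  have hI' : Integrable (fun x => |u x| ^ p * ‖x‖ ^ (δ - n)) := by
    refine hI.mono' ((hu.measurable.abs.pow_const p).mul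
      (measurable_norm.pow_const _)).aestronglyMeasurable
      (Filter.Eventually.of_forall fun x => ?_)
    rw [Real.norm_of_nonneg (by positivity)]
    exact hle δ hδ hδ1 x
  exact ⟨hI', integral_mono hI' hI (hle δ hδ hδ1)⟩

lemma exists_smoothOn_kdiff_eq_one {n k : ℕ} (hn : 0 < n) (hk : 0 < k) :
    ∃ (e : EuclideanSpace ℝ (Fin n)) (f : EuclideanSpace ℝ (Fin n) → ℝ), ‖e‖ = 1 ∧
      SmoothOn (Metric.closedBall (k • e) (1 / 2)) f ∧
      ∀ x h, ‖x‖ < 1 / 8 → ‖h - e‖ < 1 / (8 * k) → kdiff k f h x = 1 := by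
  set e : EuclideanSpace ℝ (Fin n) := EuclideanSpace.single ⟨0, hn⟩ 1 with he
  have he1 : ‖e‖ = 1 := by simp [he]
  let b : ContDiffBump (k • e) := ⟨1 / 4, 1 / 2, by norm_num, by norm_num⟩
  refine ⟨e, b, he1, ⟨b.contDiff, b.tsupport_eq.subset⟩, fun x h hx hh => ?_⟩
  have hk' : (0 : ℝ) < k := by exact_mod_cast hk
  have hkh : (k : ℝ) * ‖h - e‖ < 1 / 8 := by
    rw [lt_div_iff₀ (by positivity)] at hh
    linarith
  have hj : ∀ j : ℕ, j ≤ k → ‖x + j • (h - e)‖ < 1 / 4 := fun j hjk => by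
    have h1 : ‖j • (h - e)‖ ≤ j * ‖h - e‖ := norm_nsmul_le
    have h2 : (j : ℝ) * ‖h - e‖ ≤ k * ‖h - e‖ := by gcongr
    have h3 := norm_add_le x (j • (h - e))
    linarith
  rw [kdiff, Finset.sum_range_succ, Finset.sum_eq_zero, zero_add]
  · have : b (x + k • h) = 1 := b.one_of_mem_closedBall (by
      rw [mem_closedBall_iff_norm, add_sub_assoc, ← nsmul_sub]
      exact (hj k le_rfl).le)
    simp [this]
  · intro j hjk
    rw [Finset.mem_range] at hjk
    have h1 : ((k - j : ℕ) : ℝ) = ‖(k - j) • e‖ := by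
      rw [← Nat.cast_smul_eq_nsmul ℝ, norm_smul, he1]; simp
    have h2 : (1 : ℝ) ≤ (k - j : ℕ) := by exact_mod_cast Nat.sub_pos_of_lt hjk
    have h3 : x + j • h - k • e = (x + j • (h - e)) - (k - j) • e := by
      rw [nsmul_sub, sub_nsmul _ hjk.le]; abel
    have : b (x + j • h) = 0 := b.zero_of_le_dist (by
      rw [dist_eq_norm, h3]
      have h4 := norm_sub_norm_le ((k - j) • e) (x + j • (h - e))
      rw [norm_sub_rev] at h4
      have h5 := hj j hjk.le
      show (1 / 2 : ℝ) ≤ _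
      linarith)
    rw [this, mul_zero]

/-- If the `k`-th differences of `f` at points near the origin equal `1` for an open set of steps,
then the `p`-th power of the difference seminorm with weight `‖x‖ ^ (δ - n)` is at least a constant
times `δ⁻¹`. -/
lemma exists_le_integral_diffIntegral {n k : ℕ} (hn : 0 < n) (hk : 0 < k) {s p q : ℝ}
    (hs0 : 0 < s) (hs1 : s < 1) (hp : 0 < p) (hq : 0 < q)
    {e : EuclideanSpace ℝ (Fin n)} {f : EuclideanSpace ℝ (Fin n) → ℝ} (he : ‖e‖ = 1)
    (hf : SmoothOn (Metric.closedBall (k • e) (1 / 2)) f)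
    (hone : ∀ x h, ‖x‖ < 1 / 8 → ‖h - e‖ < 1 / (8 * k) → kdiff k f h x = 1) :
    ∃ c, 0 < c ∧ ∀ δ : ℝ, 0 < δ → δ ≤ 1 →
      c / δ ≤ ∫ x, diffIntegral k s q 2 f x ^ (p / q) * ‖x‖ ^ (δ - n) := by
  have : Nonempty (Fin n) := ⟨⟨0, hn⟩⟩
  have hk' : (1 : ℝ) ≤ k := by exact_mod_cast hk
  have hn' : (0 : ℝ) < n := by exact_mod_cast hn
  obtain ⟨B, hB, hJ⟩ := exists_diffIntegral_le hn hk hs0 hs1 hq 2 hf.1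
    (hf.hasCompactSupport (isCompact_closedBall _ _))
  set m := (n : ℝ) + s * k * q with hm
  have hm0 : 0 < m := by positivity
  set U := Metric.ball e (1 / (8 * k)) with hU
  have hUvol : 0 < volume.real U :=
    ENNReal.toReal_pos (Metric.measure_ball_pos volume e (by positivity)).ne'
      measure_ball_lt_top.ne
  set v := volume.real (Metric.ball (0 : EuclideanSpace ℝ (Fin n)) 1) with hv
  have hv0 : 0 < v :=
    ENNReal.toReal_pos (Metric.measure_ball_pos volume _ one_pos).ne' measure_ball_lt_top.ne
  have hUsub : U ⊆ Metric.ball 0 2 := fun h hh => by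
    rw [hU, mem_ball_iff_norm] at hh
    rw [mem_ball_zero_iff]
    have h1 : 1 / (8 * (k : ℝ)) ≤ 1 / 8 := by
      apply one_div_le_one_div_of_le <;> linarith
    have h2 := norm_le_norm_add_norm_sub e h
    rw [norm_sub_rev] at h2
    linarith
  set c := volume.real U * (1 / 2 ^ m) with hc
  have hc0 : 0 < c := by positivity
  have hlow : ∀ x, ‖x‖ < 1 / 8 → c ≤ diffIntegral k s q 2 f x := fun x hx => by
    calc c = ∫ _h in U, (1 / 2 ^ m : ℝ) := by rw [setIntegral_const, smul_eq_mul]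
      _ ≤ ∫ h in U, |kdiff k f h x| ^ q / ‖h‖ ^ m := by
        refine setIntegral_mono_on (integrableOn_const measure_ball_lt_top.ne)
          ((hJ x).2.mono_set hUsub) Metric.isOpen_ball.measurableSet fun h hh => ?_
        have hh2 := mem_ball_zero_iff.1 (hUsub hh)
        have hh1 := mem_ball_iff_norm.1 hh
        rw [hone x h hx hh1, abs_one, one_rpow]
        rcases eq_or_ne h 0 with rfl | h0
        · have h8 : 1 / (8 * (k : ℝ)) ≤ 1 / 8 := by
            apply one_div_le_one_div_of_le <;> linarith
          rw [zero_sub, norm_neg, he] at hh1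
          linarith
        have : 0 < ‖h‖ := norm_pos_iff.2 h0
        gcongr
      _ ≤ _ := setIntegral_mono_set (hJ x).2
          (Filter.Eventually.of_forall fun h => by positivity) hUsub.eventuallyLE
  set R : ℝ := k + 1 / 2 + k * 2 with hR
  have hsupp : ∀ x, (k : ℝ) + 1 / 2 < ‖x‖ → f x = 0 := fun x hx => by
    refine image_eq_zero_of_notMem_tsupport fun hxs => ?_
    have h1 := mem_closedBall_iff_norm.1 (hf.2 hxs)
    have h2 : ‖k • e‖ ≤ k * ‖e‖ := norm_nsmul_le
    have h3 := norm_le_norm_add_norm_sub (k • e) x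
    rw [he] at h2
    rw [norm_sub_rev] at h3
    linarith
  have hle : ∀ δ : ℝ, ∀ x, diffIntegral k s q 2 f x ^ (p / q) * ‖x‖ ^ (δ - n) ≤
      (Metric.ball 0 R).indicator (fun x => B ^ (p / q) * ‖x‖ ^ (δ - n)) x := by
    intro δ x
    by_cases hx : x ∈ Metric.ball 0 R
    · rw [indicator_of_mem hx]
      have := (hJ x).1
      have := diffIntegral_nonneg k s q 2 f x
      gcongr
    · rw [indicator_of_notMem hx, diffIntegral_eq_zero k s hq hsupp _ hk,
        zero_rpow (by positivity), zero_mul]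
      rw [mem_ball_zero_iff, not_lt] at hx
      exact hx
  refine ⟨c ^ (p / q) * (n * v * (1 / 8)), by positivity, fun δ hδ hδ1 => ?_⟩
  have hnn : ∀ x, 0 ≤ diffIntegral k s q 2 f x ^ (p / q) * ‖x‖ ^ (δ - n) := fun x =>
    mul_nonneg (rpow_nonneg (diffIntegral_nonneg k s q 2 f x) _) (rpow_nonneg (norm_nonneg x) _)
  have hI : Integrable (fun x => diffIntegral k s q 2 f x ^ (p / q) * ‖x‖ ^ (δ - n)) := by
    have hd : Integrable ((Metric.ball (0 : EuclideanSpace ℝ (Fin n)) R).indicator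
        (fun x => B ^ (p / q) * ‖x‖ ^ (δ - n))) :=
      (integrable_indicator_iff measurableSet_ball).2
        ((integrableOn_ball_norm_rpow hn hδ R).const_mul _)
    refine hd.mono' (((measurable_diffIntegral k s q 2 hf.1.continuous).pow_const _).mul
      (measurable_norm.pow_const _)).aestronglyMeasurable
      (Filter.Eventually.of_forall fun x => ?_)
    rw [Real.norm_of_nonneg (hnn x)]
    exact hle δ x
  have h8 : (1 / 8 : ℝ) ≤ (1 / 8) ^ δ := by
    conv_lhs => rw [← rpow_one (1 / 8 : ℝ)]
    exact rpow_le_rpow_of_exponent_ge (by norm_num) (by norm_num) hδ1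
  calc c ^ (p / q) * (n * v * (1 / 8)) / δ
      ≤ c ^ (p / q) * (n * v * (1 / 8) ^ δ / δ) := by
        rw [mul_div_assoc]; gcongr
    _ = ∫ x in Metric.ball (0 : EuclideanSpace ℝ (Fin n)) (1 / 8),
          c ^ (p / q) * ‖x‖ ^ (δ - n) := by
        rw [integral_const_mul, setIntegral_ball_norm_rpow hn hδ (by norm_num)]
    _ ≤ ∫ x in Metric.ball (0 : EuclideanSpace ℝ (Fin n)) (1 / 8),
          diffIntegral k s q 2 f x ^ (p / q) * ‖x‖ ^ (δ - n) := by
        refine setIntegral_mono_on ((integrableOn_ball_norm_rpow hn hδ _).const_mul _)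
          hI.integrableOn measurableSet_ball fun x hx => ?_
        have := hlow x (mem_ball_zero_iff.1 hx)
        gcongr
    _ ≤ _ := setIntegral_le_integral hI (Filter.Eventually.of_forall hnn)

lemma le_of_forall_le_mul_rpow {a b c D : ℝ} (hc : 0 < c)
    (h : ∀ δ : ℝ, 0 < δ → δ ≤ 1 → c ≤ D * δ ^ (a - b)) : a ≤ b := by
  by_contra! hab
  have hpos : 0 < a - b := sub_pos.2 hab
  have ht : Filter.Tendsto (fun δ : ℝ => D * δ ^ (a - b)) (nhdsWithin 0 (Ioi 0)) (nhds 0) := by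
    have := (Real.continuousAt_rpow_const 0 (a - b) (Or.inr hpos.le)).tendsto.const_mul D
    rw [zero_rpow hpos.ne', mul_zero] at this
    exact this.mono_left nhdsWithin_le_nhds
  refine hc.not_ge (ge_of_tendsto ht ?_)
  filter_upwards [Ioc_mem_nhdsGT (zero_lt_one' ℝ)] with δ hδ
  exact h δ hδ.1 hδ.2

/-- Proposition 2.2: sharpness of the exponent `1/p` on the `A₁`-weight constant. -/
theorem statement5 (n k : ℕ) (hn : 0 < n) (hk : 0 < k) (s p q β C : ℝ)
    (hs : s ∈ Set.Ioo (0 : ℝ) 1) (hp : 1 ≤ p) (hq : 1 ≤ q) (hC : 0 < C)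
    (H : ∀ r : ℝ, 0 < r → ∀ ω : EuclideanSpace ℝ (Fin n) → ℝ, IsA1 ω →
      ∀ f : EuclideanSpace ℝ (Fin n) → ℝ,
      ∀ g : (Fin n → ℕ) → EuclideanSpace ℝ (Fin n) → ℝ,
        LocallyIntegrable f volume →
        (∀ α ∈ multiIdx n k, HasWeakPD α f (g α)) →
        (∀ α ∈ multiIdx n k, Integrable (fun x => |g α x| ^ p * ω x)) →
        (∫ x, (∫ h in Metric.ball (0 : EuclideanSpace ℝ (Fin n)) r,
            |kdiff k f h x| ^ q / ‖h‖ ^ ((n : ℝ) + s * k * q)) ^ (p / q) * ω x) ^ (1 / p) ≤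
          C * A1const ω ^ β * r ^ ((1 - s) * (k : ℝ)) *
            (∫ x, gradNorm n k g x ^ p * ω x) ^ (1 / p)) :
    1 / p ≤ β := by
  obtain ⟨hs0, hs1⟩ := hs
  have hp0 : 0 < p := by linarith
  obtain ⟨e, f, he, hf, hone⟩ := exists_smoothOn_kdiff_eq_one hn hk
  have hk' : (1 : ℝ) ≤ k := by exact_mod_cast hk
  set S := Metric.closedBall (k • e) (1 / 2) with hSdef
  have hS : IsCompact S := isCompact_closedBall _ _
  have hS' : ∀ x ∈ S, 1 / 2 ≤ ‖x‖ := fun x hx => by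
    have h1 := mem_closedBall_iff_norm.1 hx
    have h2 : ‖k • e‖ = k := by rw [← Nat.cast_smul_eq_nsmul ℝ, norm_smul, he]; simp
    have h3 := norm_le_norm_add_norm_sub x (k • e)
    linarith
  set g : (Fin n → ℕ) → EuclideanSpace ℝ (Fin n) → ℝ :=
    fun α => pdList α (List.finRange n) f with hg
  have hgS : ∀ α, SmoothOn S (g α) := fun α => hf.pdList α _
  have hg0 : ∀ α, ∀ x ∉ S, g α x = 0 := fun α x hx =>
    image_eq_zero_of_notMem_tsupport fun h => hx ((hgS α).2 h)
  have hGc : Continuous (gradNorm n k g) :=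
    Real.continuous_sqrt.comp (continuous_finsetSum _ fun α _ => (hgS α).1.continuous.pow 2)
  have hG0 : ∀ x ∉ S, gradNorm n k g x = 0 := fun x hx => by
    simp [gradNorm, hg0 _ x hx]
  obtain ⟨M, hM0, hM⟩ := exists_integral_rpow_mul_le hS hS' hGc hG0 hn hp0
  obtain ⟨c, hc0, hc⟩ := exists_le_integral_diffIntegral hn hk hs0 hs1 hp0
    (by linarith : 0 < q) he hf hone
  obtain ⟨K, hK0, hK⟩ := exists_A1const_norm_rpow_bounds hn
  have hmain : 1 / p ≤ max β 0 := by
    refine le_of_forall_le_mul_rpow (c := c ^ (1 / p))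
      (D := C * K ^ max β 0 * 2 ^ ((1 - s) * (k : ℝ)) * M ^ (1 / p)) (by positivity)
      fun δ hδ hδ1 => ?_
    obtain ⟨hA1, hAK⟩ := hK δ hδ hδ1
    have h := H 2 two_pos _ (isA1_norm_rpow hn hδ hδ1) f g hf.1.continuous.locallyIntegrable
      (fun α _ => hasWeakPD_pdList hS α hf) fun α _ => by
        obtain ⟨_, _, h⟩ := exists_integral_rpow_mul_le hS hS' (hgS α).1.continuous (hg0 α) hn hp0
        exact (h δ hδ hδ1).1
    have h1 : (c / δ) ^ (1 / p) ≤ _ :=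
      (rpow_le_rpow (by positivity) (hc δ hδ hδ1) (by positivity)).trans h
    have h2 : A1const (fun x : EuclideanSpace ℝ (Fin n) => ‖x‖ ^ (δ - n)) ^ β ≤
        (K / δ) ^ max β 0 :=
      (rpow_le_rpow_of_exponent_le hA1 (le_max_left _ _)).trans
        (rpow_le_rpow (zero_le_one.trans hA1) hAK (le_max_right _ _))
    have h3 : ∫ x, gradNorm n k g x ^ p * ‖x‖ ^ (δ - n) ≤ M := by
      have h4 : ∀ x, |gradNorm n k g x| = gradNorm n k g x := fun x =>
        abs_of_nonneg (Real.sqrt_nonneg _)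
      simpa only [h4] using (hM δ hδ hδ1).2
    have h5 : 0 ≤ ∫ x, gradNorm n k g x ^ p * ‖x‖ ^ (δ - n) := integral_nonneg fun x =>
      mul_nonneg (rpow_nonneg (Real.sqrt_nonneg _) _) (rpow_nonneg (norm_nonneg _) _)
    have h6 : (c / δ) ^ (1 / p) ≤
        C * (K / δ) ^ max β 0 * 2 ^ ((1 - s) * (k : ℝ)) * M ^ (1 / p) := by
      refine h1.trans ?_
      gcongr
    rw [div_rpow hc0.le hδ.le, div_le_iff₀ (by positivity), div_rpow hK0.le hδ.le] at h6
    rw [rpow_sub hδ]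
    refine h6.trans_eq ?_
    ring
  rcases le_max_iff.1 hmain with h | h
  · exact h
  · exact absurd h (not_le.2 (by positivity))

end
end

section
/- Let $p\in(1,\infty)$ and let $\gamma\in(0,\infty)$. Suppose $q\in[1,\infty)$ satisfies $n(\frac{1}{p}-\frac{1}{q})<1$ and there exists a constant $C>0$ such that for every $s\in(0,1)$ and every $f\in\dot{W}^{1,p}(\mathbb{R}^n)$, $(1-s)^\gamma\left(\int_{\mathbb{R}^n}\left(\int_{|h|\le 1}\frac{|f(x+h)-f(x)|^q}{|h|^{n+sq}}\,dh\right)^{p/q}\,dx\right)^{1/p}\le C\,\|\,|\nabla f|\,\|_{L^p}$. Then $\gamma\ge 1/q$. -/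
open MeasureTheory Real Set
open scoped Classical ENNReal

noncomputable section

open Paper

/-- The multi-index derivative of order `e_i` is the `i`-th partial derivative. -/
lemma pdMulti_single {n : ℕ} (i : Fin n) (φ : EuclideanSpace ℝ (Fin n) → ℝ) :
    pdMulti (Pi.single i 1) φ = pd i φ := by
  have key : ∀ l : List (Fin n), l.Nodup →
      l.foldr (fun j ψ => (pd j)^[(Pi.single i 1 : Fin n → ℕ) j] ψ) φ =
        if i ∈ l then pd i φ else φ := by
    intro l
    induction l with
    | nil => simp
    | cons a l ih =>
      intro hl
      rw [List.nodup_cons] at hl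
      rw [List.foldr_cons, ih hl.2]
      by_cases h : a = i
      · subst h
        simp [hl.1]
      · simp [h, Ne.symm h]
  rw [pdMulti, key _ (List.nodup_finRange n)]
  simp

/-- The classical partial derivatives of a smooth function are weak partial derivatives. -/
lemma hasWeakPD_single {n : ℕ} {f : EuclideanSpace ℝ (Fin n) → ℝ}
    (hf : ContDiff ℝ (⊤ : ℕ∞) f) (i : Fin n) :
    HasWeakPD (Pi.single i 1) f (pd i f) := by
  intro φ hφ hφc
  have hcf : Continuous (fun x => fderiv ℝ f x (EuclideanSpace.single i 1)) :=
    (hf.continuous_fderiv (by simp)).clm_apply continuous_const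
  have hcφ : Continuous (fun x => fderiv ℝ φ x (EuclideanSpace.single i 1)) :=
    (hφ.continuous_fderiv (by simp)).clm_apply continuous_const
  have hsum : ∑ j, (Pi.single i 1 : Fin n → ℕ) j = 1 := by simp
  rw [pdMulti_single, hsum, pow_one, neg_one_mul]
  refine integral_mul_fderiv_eq_neg_fderiv_mul_of_integrable ?_ ?_ ?_ ?_ ?_
  · exact (hcf.mul hφ.continuous).integrable_of_hasCompactSupport hφc.mul_left
  · exact (hf.continuous.mul hcφ).integrable_of_hasCompactSupport
      (hφc.fderiv_apply ℝ _).mul_left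
  · exact (hf.continuous.mul hφ.continuous).integrable_of_hasCompactSupport hφc.mul_left
  · exact fun x _ => hf.differentiable (by simp) x
  · exact fun x _ => hφ.differentiable (by simp) x

/-- Integrability and value of the radial kernel `|h|^{q-n-sq}` on the unit ball. -/
lemma radial_kernel {n : ℕ} (hn : 0 < n) {q s : ℝ} (hq : 0 < q) (hs : s < 1) :
    IntegrableOn (fun h : EuclideanSpace ℝ (Fin n) => ‖h‖ ^ q / ‖h‖ ^ ((n : ℝ) + s * q))
      (Metric.closedBall 0 1) ∧
    ∫ h in Metric.closedBall (0 : EuclideanSpace ℝ (Fin n)) 1,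
        ‖h‖ ^ q / ‖h‖ ^ ((n : ℝ) + s * q) =
      n * volume.real (Metric.ball (0 : EuclideanSpace ℝ (Fin n)) 1) * (1 / (q * (1 - s))) := by
  have : Nonempty (Fin n) := ⟨⟨0, hn⟩⟩
  have hpos : 0 < q * (1 - s) := mul_pos hq (by linarith)
  set k : ℝ → ℝ := (Iic (1 : ℝ)).indicator (fun r => r ^ q / r ^ ((n : ℝ) + s * q)) with hk
  have hind : (Metric.closedBall (0 : EuclideanSpace ℝ (Fin n)) 1).indicator
      (fun h => ‖h‖ ^ q / ‖h‖ ^ ((n : ℝ) + s * q)) = fun h => k ‖h‖ := by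
    funext h
    simp [hk, Set.indicator_apply]
  have hker : EqOn (fun y : ℝ => y ^ (Module.finrank ℝ (EuclideanSpace ℝ (Fin n)) - 1) • k y)
      ((Iic (1 : ℝ)).indicator fun y => y ^ (q * (1 - s) - 1)) (Ioi 0) := by
    intro y hy
    have hy : 0 < y := hy
    by_cases h1 : y ≤ 1
    · have e : y ^ (n - 1) = y ^ ((n : ℝ) - 1) := by
        rw [← Real.rpow_natCast, Nat.cast_sub hn, Nat.cast_one]
      simp only [hk, finrank_euclideanSpace, Fintype.card_fin, smul_eq_mul,
        Set.indicator_of_mem (show y ∈ Iic (1 : ℝ) from h1)]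
      rw [e, ← Real.rpow_sub hy, ← Real.rpow_add hy]
      congr 1
      ring
    · simp [hk, h1]
  have hset : Ioi (0 : ℝ) ∩ Iic 1 = Ioc 0 1 := Ioi_inter_Iic
  constructor
  · rw [← integrable_indicator_iff measurableSet_closedBall, hind, integrable_fun_norm_addHaar,
      integrableOn_congr_fun hker measurableSet_Ioi,
      integrableOn_indicator_iff measurableSet_Iic, inter_comm, hset,
      ← intervalIntegrable_iff_integrableOn_Ioc_of_le zero_le_one]
    exact intervalIntegral.intervalIntegrable_rpow' (by linarith)
  · rw [← integral_indicator measurableSet_closedBall, hind, integral_fun_norm_addHaar,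
      setIntegral_congr_fun measurableSet_Ioi hker, setIntegral_indicator measurableSet_Iic, hset,
      ← intervalIntegral.integral_of_le zero_le_one, integral_rpow (Or.inl (by linarith))]
    simp [Real.zero_rpow hpos.ne']
    ring

/-- A compactly supported smooth function agreeing with the `i`-th coordinate near the origin. -/
lemma exists_smooth_coordinate {n : ℕ} (i : Fin n) :
    ∃ f : EuclideanSpace ℝ (Fin n) → ℝ, ContDiff ℝ (⊤ : ℕ∞) f ∧ HasCompactSupport f ∧
      (∀ x, ‖x‖ ≤ 2 → f x = x i) := by
  let b : ContDiffBump (0 : EuclideanSpace ℝ (Fin n)) := ⟨2, 3, by norm_num, by norm_num⟩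
  refine ⟨fun x => b x * x i, ?_, ?_, ?_⟩
  · refine b.contDiff.mul ?_
    fun_prop
  · exact b.hasCompactSupport.mul_right
  · intro x hx
    have : b x = 1 := b.one_of_mem_closedBall (by simpa using hx)
    simp [this]

/-- The localized Gagliardo energy density of a Lipschitz compactly supported function,
raised to a positive power, is integrable. -/
lemma integrable_gagliardo {n : ℕ} (hn : 0 < n) {f : EuclideanSpace ℝ (Fin n) → ℝ} {L : NNReal}
    (hL : LipschitzWith L f) (hc : HasCompactSupport f) {q s r : ℝ} (hq : 0 < q) (hs : s < 1)
    (hr : 0 < r) :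
    Integrable (fun x => (∫ h in Metric.closedBall (0 : EuclideanSpace ℝ (Fin n)) 1,
      |f (x + h) - f x| ^ q / ‖h‖ ^ ((n : ℝ) + s * q)) ^ r) := by
  set G : EuclideanSpace ℝ (Fin n) → ℝ := fun x =>
    ∫ h in Metric.closedBall (0 : EuclideanSpace ℝ (Fin n)) 1,
      |f (x + h) - f x| ^ q / ‖h‖ ^ ((n : ℝ) + s * q) with hG
  have hfm : Measurable f := hL.continuous.measurable
  have hGm : StronglyMeasurable G := by
    refine StronglyMeasurable.integral_prod_right (Measurable.stronglyMeasurable ?_)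
    unfold Function.uncurry
    fun_prop
  have hG0 : ∀ x, 0 ≤ G x := fun x => integral_nonneg fun h => by positivity
  obtain ⟨M, hM⟩ : ∃ M, ∀ x, G x ≤ M := by
    refine ⟨_, fun x => integral_mono_of_nonneg (Filter.Eventually.of_forall fun h => by positivity)
      ((radial_kernel hn hq hs).1.const_mul ((L : ℝ) ^ q))
      (Filter.Eventually.of_forall fun h => ?_)⟩
    have h1 : |f (x + h) - f x| ≤ L * ‖h‖ := by
      have := hL.dist_le_mul (x + h) x
      simpa [Real.dist_eq] using this
    have h2 : |f (x + h) - f x| ^ q ≤ (L : ℝ) ^ q * ‖h‖ ^ q := by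
      rw [← Real.mul_rpow (by positivity) (by positivity)]
      exact Real.rpow_le_rpow (abs_nonneg _) h1 hq.le
    change _ ≤ (L : ℝ) ^ q * (‖h‖ ^ q / ‖h‖ ^ ((n : ℝ) + s * q))
    rw [← mul_div_assoc]
    exact div_le_div_of_nonneg_right h2 (by positivity)
  obtain ⟨R, hR⟩ := hc.isCompact.isBounded.subset_closedBall (0 : EuclideanSpace ℝ (Fin n))
  have hf0 : ∀ x, R < ‖x‖ → f x = 0 := fun x hx => by
    by_contra hne
    have := hR (subset_tsupport f hne)
    simp at this
    linarith
  have hsupp : ∀ x, x ∉ Metric.closedBall (0 : EuclideanSpace ℝ (Fin n)) (R + 1) →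
      G x ^ r = 0 := by
    intro x hx
    have hx : R + 1 < ‖x‖ := by simpa using hx
    have : G x = 0 := by
      refine setIntegral_eq_zero_of_forall_eq_zero fun h hh => ?_
      have hh : ‖h‖ ≤ 1 := by simpa using hh
      have h3 : ‖x‖ ≤ ‖x + h‖ + ‖h‖ := by simpa using norm_sub_le (x + h) h
      rw [hf0 x (by linarith), hf0 (x + h) (by linarith)]
      simp [Real.zero_rpow hq.ne']
    rw [this, Real.zero_rpow hr.ne']
  have hm : Measurable fun x => G x ^ r := hGm.measurable.pow_const r
  refine IntegrableOn.integrable_of_forall_notMem_eq_zero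
    (s := Metric.closedBall (0 : EuclideanSpace ℝ (Fin n)) (R + 1)) ?_ hsupp
  refine Measure.integrableOn_of_bounded (M := M ^ r) ?_ hm.aestronglyMeasurable ?_
  · exact measure_closedBall_lt_top.ne
  · refine Filter.Eventually.of_forall fun x => ?_
    rw [Real.norm_of_nonneg (Real.rpow_nonneg (hG0 x) r)]
    exact Real.rpow_le_rpow (hG0 x) (hM x) hr.le

/-- A power bound `t^a ≤ K t` near `0` forces `a ≥ 1`. -/
lemma one_le_of_rpow_le_mul {a K : ℝ} (h : ∀ t ∈ Ioo (0 : ℝ) 1, t ^ a ≤ K * t) : 1 ≤ a := by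
  by_contra! ha
  have ht := tendsto_rpow_neg_nhdsGT_zero (show a - 1 < 0 by linarith)
  have hmem : Ioo (0 : ℝ) 1 ∈ nhdsWithin 0 (Ioi (0 : ℝ)) := Ioo_mem_nhdsGT one_pos
  obtain ⟨t, h1, h2⟩ := ((ht.eventually_gt_atTop K).and hmem).exists
  have h3 := h t h2
  rw [Real.rpow_sub_one h2.1.ne', lt_div_iff₀ h2.1] at h1
  linarith

/-- The `q`-th power of the Euclidean norm is controlled by the coordinates. -/
lemma norm_rpow_le_sum {n : ℕ} {q : ℝ} (hq : 1 ≤ q) (h : EuclideanSpace ℝ (Fin n)) :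
    ‖h‖ ^ q ≤ (n : ℝ) ^ (q - 1) * ∑ i, |h i| ^ q := by
  have h1 : ‖h‖ ≤ ∑ i, |h i| := by
    rw [EuclideanSpace.norm_eq]
    refine Real.sqrt_le_iff.2 ⟨by positivity, ?_⟩
    simpa using Finset.sum_sq_le_sq_sum_of_nonneg (s := Finset.univ) (f := fun i => |h i|)
      (fun i _ => abs_nonneg _)
  calc ‖h‖ ^ q ≤ (∑ i, |h i|) ^ q := Real.rpow_le_rpow (norm_nonneg _) h1 (by linarith)
    _ ≤ _ := by
      simpa using Real.rpow_sum_le_const_mul_sum_rpow Finset.univ (fun i => h i) hq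

/-- The directional kernel is integrable on the unit ball. -/
lemma integrableOn_directional_kernel {n : ℕ} (hn : 0 < n) {q s : ℝ} (hq : 0 < q) (hs : s < 1)
    (i : Fin n) :
    IntegrableOn (fun h : EuclideanSpace ℝ (Fin n) => |h i| ^ q / ‖h‖ ^ ((n : ℝ) + s * q))
      (Metric.closedBall 0 1) := by
  refine (radial_kernel hn hq hs).1.mono' (Measurable.aestronglyMeasurable (by fun_prop))
    (Filter.Eventually.of_forall fun h => ?_)
  rw [Real.norm_of_nonneg (by positivity)]
  gcongr
  simpa using PiLp.norm_apply_le h i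

/-- Proposition 2.6 (case `p ∈ (1,∞)`): sharpness of the factor `(1-s)^{1/q}`. -/
theorem statement6 (n : ℕ) (hn : 0 < n) (p γ q C : ℝ) (hp : 1 < p) (hγ : 0 < γ)
    (hq : 1 ≤ q) (hpq : (n : ℝ) * (1 / p - 1 / q) < 1) (hC : 0 < C)
    (H : ∀ s ∈ Set.Ioo (0 : ℝ) 1, ∀ f : EuclideanSpace ℝ (Fin n) → ℝ,
      ∀ g : Fin n → EuclideanSpace ℝ (Fin n) → ℝ,
        LocallyIntegrable f volume →
        (∀ i, HasWeakPD (Pi.single i 1) f (g i)) →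
        (∀ i, Integrable (fun x => |g i x| ^ p)) →
        (1 - s) ^ γ *
            (∫ x, (∫ h in Metric.closedBall (0 : EuclideanSpace ℝ (Fin n)) 1,
                |f (x + h) - f x| ^ q / ‖h‖ ^ ((n : ℝ) + s * q)) ^ (p / q)) ^ (1 / p) ≤
          C * (∫ x, Real.sqrt (∑ i, g i x ^ 2) ^ p) ^ (1 / p)) :
    1 / q ≤ γ := by
  have hq0 : 0 < q := by linarith
  have hp0 : 0 < p := by linarith
  set B := Metric.closedBall (0 : EuclideanSpace ℝ (Fin n)) 1 with hB
  set V : ℝ := volume.real B with hV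
  have hVpos : 0 < V :=
    ENNReal.toReal_pos (Metric.measure_closedBall_pos _ _ one_pos).ne' measure_closedBall_lt_top.ne
  have hbV : 0 < volume.real (Metric.ball (0 : EuclideanSpace ℝ (Fin n)) 1) :=
    ENNReal.toReal_pos (Metric.measure_ball_pos _ _ one_pos).ne' measure_ball_lt_top.ne
  have step : ∀ i : Fin n, ∃ K : ℝ, ∀ s ∈ Ioo (0 : ℝ) 1,
      (1 - s) ^ (γ * q) * ∫ h in B, |h i| ^ q / ‖h‖ ^ ((n : ℝ) + s * q) ≤ K := by
    intro i
    obtain ⟨f, hf, hfc, hfi⟩ := exists_smooth_coordinate i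
    obtain ⟨L, hL⟩ := ContDiff.lipschitzWith_of_hasCompactSupport hfc hf (by simp)
    set A : ℝ := C * (∫ x, Real.sqrt (∑ j, pd j f x ^ 2) ^ p) ^ (1 / p)
    refine ⟨(A / V ^ (1 / p)) ^ q, fun s hs => ?_⟩
    have hs1 : 0 < 1 - s := by linarith [hs.2]
    set I : ℝ := ∫ h in B, |h i| ^ q / ‖h‖ ^ ((n : ℝ) + s * q) with hI
    have hI0 : 0 ≤ I := integral_nonneg fun h => by positivity
    have hmain := H s hs f (fun j => pd j f) hf.continuous.locallyIntegrable
      (fun j => hasWeakPD_single hf j) (fun j => by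
        have hcont : Continuous (pd j f) :=
          (hf.continuous_fderiv (by simp)).clm_apply continuous_const
        refine (hcont.abs.rpow_const fun _ => Or.inr hp0.le).integrable_of_hasCompactSupport ?_
        exact (hfc.fderiv_apply ℝ (EuclideanSpace.single j 1)).comp_left
          (g := fun t : ℝ => |t| ^ p) (by simp [Real.zero_rpow hp0.ne']))
    have hlow : V * I ^ (p / q) ≤ ∫ x, (∫ h in B,
        |f (x + h) - f x| ^ q / ‖h‖ ^ ((n : ℝ) + s * q)) ^ (p / q) := by
      have hint := integrable_gagliardo hn hL hfc hq0 hs.2 (div_pos hp0 hq0)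
      refine le_trans (le_of_eq ?_) (setIntegral_le_integral (s := B) hint
        (Filter.Eventually.of_forall fun x =>
          Real.rpow_nonneg (integral_nonneg fun h => by positivity) _))
      have hcongr : EqOn (fun x => (∫ h in B,
          |f (x + h) - f x| ^ q / ‖h‖ ^ ((n : ℝ) + s * q)) ^ (p / q))
          (fun _ => I ^ (p / q)) B := by
        intro x hx
        have hx : ‖x‖ ≤ 1 := by simpa [hB] using hx
        have : (∫ h in B, |f (x + h) - f x| ^ q / ‖h‖ ^ ((n : ℝ) + s * q)) = I := by
          refine setIntegral_congr_fun measurableSet_closedBall fun h hh => ?_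
          have hh : ‖h‖ ≤ 1 := by simpa [hB] using hh
          have hxh : ‖x + h‖ ≤ 2 := (norm_add_le x h).trans (by linarith)
          simp only
          rw [hfi _ hxh, hfi x (by linarith)]
          simp
        simp only [this]
      rw [setIntegral_congr_fun measurableSet_closedBall hcongr, setIntegral_const, smul_eq_mul]
    have h1 : (1 - s) ^ γ * (V ^ (1 / p) * I ^ (1 / q)) ≤ A := by
      refine le_trans ?_ hmain
      have e : V ^ (1 / p) * I ^ (1 / q) = (V * I ^ (p / q)) ^ (1 / p) := by
        rw [Real.mul_rpow hVpos.le (by positivity), ← Real.rpow_mul hI0]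
        congr 2
        field_simp
      rw [e]
      gcongr
    have h2 : (1 - s) ^ γ * I ^ (1 / q) ≤ A / V ^ (1 / p) := by
      rw [le_div_iff₀ (by positivity)]
      linarith
    have h3 := Real.rpow_le_rpow (by positivity) h2 hq0.le
    rwa [Real.mul_rpow (by positivity) (by positivity), ← Real.rpow_mul hs1.le,
      ← Real.rpow_mul hI0, one_div_mul_cancel hq0.ne', Real.rpow_one] at h3
  choose K hK using step
  set D : ℝ := n * volume.real (Metric.ball (0 : EuclideanSpace ℝ (Fin n)) 1)
  have hD : 0 < D := mul_pos (by exact_mod_cast hn) hbV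
  have hone : 1 ≤ γ * q := by
    refine one_le_of_rpow_le_mul (K := (n : ℝ) ^ (q - 1) * (∑ i, K i) * q / D) fun t ht => ?_
    have hs : 1 - t ∈ Ioo (0 : ℝ) 1 := ⟨by linarith [ht.2], by linarith [ht.1]⟩
    obtain ⟨-, hval⟩ := radial_kernel hn hq0 hs.2
    have hsum : D * (1 / (q * t)) ≤ (n : ℝ) ^ (q - 1) *
        ∑ i, ∫ h in B, |h i| ^ q / ‖h‖ ^ ((n : ℝ) + (1 - t) * q) := by
      rw [sub_sub_cancel] at hval
      rw [← hval, ← integral_finsetSum _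
        (fun i _ => integrableOn_directional_kernel hn hq0 hs.2 i), ← integral_const_mul]
      refine integral_mono_of_nonneg (Filter.Eventually.of_forall fun h => by positivity)
        ((integrable_finsetSum _
          fun i _ => integrableOn_directional_kernel hn hq0 hs.2 i).const_mul _)
        (Filter.Eventually.of_forall fun h => ?_)
      simp only
      rw [← Finset.sum_div, ← mul_div_assoc]
      gcongr
      exact norm_rpow_le_sum hq h
    have hKs : t ^ (γ * q) * ∑ i, ∫ h in B, |h i| ^ q / ‖h‖ ^ ((n : ℝ) + (1 - t) * q)
        ≤ ∑ i, K i := by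
      rw [Finset.mul_sum]
      refine Finset.sum_le_sum fun i _ => ?_
      simpa using hK i (1 - t) hs
    have hfin : t ^ (γ * q) * (D * (1 / (q * t))) ≤ (n : ℝ) ^ (q - 1) * ∑ i, K i := by
      calc t ^ (γ * q) * (D * (1 / (q * t)))
          ≤ t ^ (γ * q) * ((n : ℝ) ^ (q - 1) *
            ∑ i, ∫ h in B, |h i| ^ q / ‖h‖ ^ ((n : ℝ) + (1 - t) * q)) :=
            mul_le_mul_of_nonneg_left hsum (Real.rpow_nonneg ht.1.le _)
        _ = (n : ℝ) ^ (q - 1) * (t ^ (γ * q) *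
            ∑ i, ∫ h in B, |h i| ^ q / ‖h‖ ^ ((n : ℝ) + (1 - t) * q)) := by ring
        _ ≤ _ := by gcongr
    have hqt : 0 < q * t := mul_pos hq0 ht.1
    have e1 : t ^ (γ * q) = t ^ (γ * q) * (D * (1 / (q * t))) * (q * t / D) := by
      have := ht.1.ne'
      field_simp
    have e2 : (n : ℝ) ^ (q - 1) * (∑ i, K i) * q / D * t =
        (n : ℝ) ^ (q - 1) * (∑ i, K i) * (q * t / D) := by ring
    rw [e1, e2]
    exact mul_le_mul_of_nonneg_right hfin (by positivity)
  rwa [div_le_iff₀ hq0]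

end
end

section
/- Let $k\in\mathbb{N}$, $p\in[1,\infty)$, $\omega\in A_1$, and $q\in[1,p]$. Then there exists a constant $C>0$ depending only on $n,k,p,q$ such that for any $s\in(0,1)$, $r\in(0,\infty)$, and $f\in L^p_\omega(\mathbb{R}^n)$, $s^{1/q}\left(\int_{\mathbb{R}^n}\left(\int_{B(\mathbf{0},r)^\complement}\frac{|\Delta_h^k f(x)|^q}{|h|^{n+skq}}\,dh\right)^{p/q}\omega(x)\,dx\right)^{1/p}\le C\,[\omega]_{A_1}^{2/p}\,r^{-sk}\,\|f\|_{L^p_\omega}$. -/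
open MeasureTheory Real Set
open scoped Classical ENNReal

noncomputable section

open Paper

namespace Paper

variable {n : ℕ}

theorem IsCube.measurableSet {Q : Set (EuclideanSpace ℝ (Fin n))} (hQ : IsCube Q) :
    MeasurableSet Q := by
  obtain ⟨a, l, -, rfl⟩ := hQ
  have : {x : EuclideanSpace ℝ (Fin n) | ∀ i, x i ∈ Set.Ico (a i) (a i + l)} =
      ⋂ i, (fun x : EuclideanSpace ℝ (Fin n) => x i) ⁻¹' Set.Ico (a i) (a i + l) := by
    ext x; simp
  rw [this]
  exact MeasurableSet.iInter fun i => (by fun_prop : Measurable _) measurableSet_Ico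

theorem volume_cube (a : EuclideanSpace ℝ (Fin n)) (l : ℝ) :
    volume {x : EuclideanSpace ℝ (Fin n) | ∀ i, x i ∈ Set.Ico (a i) (a i + l)} =
      ENNReal.ofReal l ^ n := by
  have h : {x : EuclideanSpace ℝ (Fin n) | ∀ i, x i ∈ Set.Ico (a i) (a i + l)} =
      (WithLp.ofLp : EuclideanSpace ℝ (Fin n) → Fin n → ℝ) ⁻¹'
        Set.pi univ fun i => Set.Ico (a i) (a i + l) := by
    ext x; simp
  rw [h, (PiLp.volume_preserving_ofLp (Fin n)).measure_preimage
    (MeasurableSet.univ_pi fun i => measurableSet_Ico).nullMeasurableSet, Real.volume_pi_Ico]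
  simp

theorem IsCube.volume_ne_top {Q : Set (EuclideanSpace ℝ (Fin n))} (hQ : IsCube Q) :
    volume Q ≠ ⊤ := by
  obtain ⟨a, l, -, rfl⟩ := hQ
  rw [volume_cube]
  finiteness

theorem IsCube.volume_ne_zero {Q : Set (EuclideanSpace ℝ (Fin n))} (hQ : IsCube Q) :
    volume Q ≠ 0 := by
  obtain ⟨a, l, hl, rfl⟩ := hQ
  rw [volume_cube]
  exact pow_ne_zero _ (by simpa using hl)

theorem IsCube.integrableOn {ω : EuclideanSpace ℝ (Fin n) → ℝ} (hω : LocallyIntegrable ω volume)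
    {Q : Set (EuclideanSpace ℝ (Fin n))} (hQ : IsCube Q) : IntegrableOn ω Q := by
  obtain ⟨a, l, hl, rfl⟩ := hQ
  have hK : IsCompact ((WithLp.ofLp : EuclideanSpace ℝ (Fin n) → Fin n → ℝ) ⁻¹'
      Set.Icc (fun i => a i) (fun i => a i + l)) := by
    have := (isCompact_Icc (a := fun i => a i) (b := fun i => a i + l)).image
      (PiLp.continuous_toLp 2 (fun _ : Fin n => ℝ))
    convert this using 1
    ext x
    constructor
    · intro hx
      exact ⟨_, hx, rfl⟩
    · rintro ⟨y, hy, rfl⟩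
      exact hy
  refine (hω.integrableOn_isCompact hK).mono_set fun x hx => ?_
  exact ⟨fun i => (hx i).1, fun i => (hx i).2.le⟩

/-- The cube of side `3ρ` around the cell with index `m` in the grid of side `ρ`. -/
def gridCube (ρ : ℝ) (m : Fin n → ℤ) : Set (EuclideanSpace ℝ (Fin n)) :=
  {x | ∀ i, x i ∈ Set.Ico ((WithLp.toLp 2 fun i => ρ * (m i - 1) : EuclideanSpace ℝ (Fin n)) i)
    ((WithLp.toLp 2 fun i => ρ * (m i - 1) : EuclideanSpace ℝ (Fin n)) i + 3 * ρ)}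

theorem isCube_gridCube {ρ : ℝ} (hρ : 0 < ρ) (m : Fin n → ℤ) : IsCube (gridCube ρ m) :=
  ⟨_, _, by positivity, rfl⟩

theorem volume_gridCube (ρ : ℝ) (m : Fin n → ℤ) :
    volume (gridCube ρ m) = ENNReal.ofReal (3 * ρ) ^ n :=
  volume_cube _ _

theorem ball_subset_gridCube {ρ : ℝ} (hρ : 0 < ρ) (z : EuclideanSpace ℝ (Fin n)) :
    Metric.ball z ρ ⊆ gridCube ρ fun i => ⌊z i / ρ⌋ := by
  intro x hx i
  have h1 : |x i - z i| < ρ := by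
    have := PiLp.norm_apply_le (x - z) i
    rw [mem_ball_iff_norm] at hx
    exact this.trans_lt hx
  rw [abs_lt] at h1
  have h2 := Int.floor_le (z i / ρ)
  have h3 := Int.lt_floor_add_one (z i / ρ)
  rw [le_div_iff₀ hρ] at h2
  rw [div_lt_iff₀ hρ] at h3
  simp only [Set.mem_Ico]
  constructor <;> nlinarith

theorem MemA1.mono {ω : EuclideanSpace ℝ (Fin n) → ℝ} (h0 : ∀ x, 0 ≤ ω x) {C D : ℝ}
    (hC : MemA1 ω C) (hCD : C ≤ D) : MemA1 ω D := fun Q hQ => by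
  filter_upwards [hC Q hQ] with y hy
  exact hy.trans (mul_le_mul_of_nonneg_right hCD (h0 y))

theorem A1const_eq (ω : EuclideanSpace ℝ (Fin n) → ℝ) :
    A1const ω = sInf {C : ℝ | 0 ≤ C ∧ MemA1 ω C} := by
  simp [A1const, ApConst, MemAp]

theorem A1const_nonneg (ω : EuclideanSpace ℝ (Fin n) → ℝ) : 0 ≤ A1const ω := by
  rw [A1const_eq]
  exact Real.sInf_nonneg fun C hC => hC.1

theorem IsAp.memA1_A1const {ω : EuclideanSpace ℝ (Fin n) → ℝ} (hω : IsA1 ω) :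
    MemA1 ω (A1const ω) := by
  obtain ⟨h0, -, C, hC⟩ := hω
  replace hC : MemA1 ω C := by simpa [MemAp] using hC
  have hne : {C : ℝ | 0 ≤ C ∧ MemA1 ω C}.Nonempty :=
    ⟨max C 0, le_max_right _ _, hC.mono h0 (le_max_left _ _)⟩
  intro Q hQ
  have key : ∀ m : ℕ, ∀ᵐ y ∂(volume.restrict Q),
      (⨍ x in Q, ω x) ≤ (A1const ω + 1 / (m + 1)) * ω y := fun m => by
    obtain ⟨D, hD, hlt⟩ := exists_lt_of_csInf_lt hne
      (b := A1const ω + 1 / ((m : ℝ) + 1)) (by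
        rw [← A1const_eq]
        linarith [Nat.one_div_pos_of_nat (α := ℝ) (n := m)])
    exact hD.2.mono h0 hlt.le Q hQ
  filter_upwards [ae_all_iff.2 key] with y hy
  have : Filter.Tendsto (fun m : ℕ => (A1const ω + 1 / ((m : ℝ) + 1)) * ω y) Filter.atTop
      (nhds ((A1const ω + 0) * ω y)) :=
    (tendsto_one_div_add_atTop_nhds_zero_nat.const_add _).mul_const _
  rw [add_zero] at this
  exact ge_of_tendsto' this hy

theorem ae_of_forall_gridCube {ρ : ℝ} (hρ : 0 < ρ) {P : EuclideanSpace ℝ (Fin n) → Prop}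
    (h : ∀ m : Fin n → ℤ, ∀ᵐ y ∂(volume.restrict (gridCube ρ m)), P y) : ∀ᵐ y, P y := by
  have h' : ∀ m : Fin n → ℤ, ∀ᵐ y, y ∈ gridCube ρ m → P y := fun m =>
    (ae_restrict_iff' (isCube_gridCube hρ m).measurableSet).1 (h m)
  filter_upwards [ae_all_iff.2 h'] with y hy
  exact hy _ (ball_subset_gridCube hρ y (Metric.mem_ball_self hρ))

theorem IsAp.ae_eq_zero_of_A1const_lt_one {ω : EuclideanSpace ℝ (Fin n) → ℝ} (hω : IsA1 ω)
    (hlt : A1const ω < 1) : ω =ᵐ[volume] 0 := by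
  refine ae_of_forall_gridCube one_pos fun m => ?_
  have hQ := isCube_gridCube one_pos m
  have hint := hQ.integrableOn hω.2.1
  have hfin : IsFiniteMeasure (volume.restrict (gridCube 1 m)) :=
    ⟨by simpa using hQ.volume_ne_top.lt_top⟩
  have hnz : NeZero (volume.restrict (gridCube 1 m)) :=
    ⟨by simpa using hQ.volume_ne_zero⟩
  set A := ⨍ x in gridCube 1 m, ω x with hA
  have h1 : A ≤ A1const ω * A := by
    calc A = ⨍ _ in gridCube 1 m, A := by rw [average_const]
      _ ≤ ⨍ y in gridCube 1 m, A1const ω * ω y := by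
        rw [average_eq, average_eq]
        refine smul_le_smul_of_nonneg_left ?_ (by positivity)
        exact integral_mono_ae (integrable_const _) (hint.const_mul _)
          (hω.memA1_A1const _ hQ)
      _ = A1const ω * A := by
        rw [hA, average_eq, average_eq, integral_const_mul, smul_eq_mul, smul_eq_mul]
        ring
  have hAnn : 0 ≤ A := by
    rw [hA, average_eq]
    exact smul_nonneg (by positivity) (integral_nonneg hω.1)
  have hA0 : A = 0 := by nlinarith
  have hint0 : ∫ x in gridCube 1 m, ω x = 0 := by
    rw [hA, average_eq, smul_eq_mul] at hA0
    refine (mul_eq_zero.1 hA0).resolve_left (inv_ne_zero ?_)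
    simp [Measure.real, ENNReal.toReal_eq_zero_iff, hQ.volume_ne_zero, hQ.volume_ne_top]
  exact (integral_eq_zero_iff_of_nonneg hω.1 hint).1 hint0

theorem IsAp.ae_setLIntegral_ball_le {ω : EuclideanSpace ℝ (Fin n) → ℝ} (hω : IsA1 ω)
    {ρ : ℝ} (hρ : 0 < ρ) :
    ∀ᵐ z, ∫⁻ x in Metric.ball z ρ, ENNReal.ofReal (ω x) ≤
      ENNReal.ofReal (A1const ω) * ENNReal.ofReal (3 * ρ) ^ n * ENNReal.ofReal (ω z) := by
  have hall : ∀ m : Fin n → ℤ, ∀ᵐ z, z ∈ gridCube ρ m →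
      ∫⁻ x in gridCube ρ m, ENNReal.ofReal (ω x) ≤
        ENNReal.ofReal (A1const ω) * ENNReal.ofReal (3 * ρ) ^ n * ENNReal.ofReal (ω z) := by
    intro m
    have hQ := isCube_gridCube hρ m
    filter_upwards [(ae_restrict_iff' hQ.measurableSet).1 (hω.memA1_A1const _ hQ)] with z hz hzQ
    have hz' := hz hzQ
    rw [setAverage_eq, smul_eq_mul, inv_mul_le_iff₀ (by
      rw [Measure.real, ENNReal.toReal_pos_iff]
      exact ⟨pos_iff_ne_zero.2 hQ.volume_ne_zero, hQ.volume_ne_top.lt_top⟩)] at hz'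
    rw [← ofReal_integral_eq_lintegral_ofReal (hQ.integrableOn hω.2.1) (ae_of_all _ hω.1)]
    refine (ENNReal.ofReal_le_ofReal hz').trans_eq ?_
    rw [ENNReal.ofReal_mul measureReal_nonneg, ENNReal.ofReal_mul (A1const_nonneg ω),
      ofReal_measureReal hQ.volume_ne_top, volume_gridCube]
    ring
  filter_upwards [ae_all_iff.2 hall] with z hz
  have hsub := ball_subset_gridCube hρ z
  exact (lintegral_mono_set hsub).trans (hz _ (hsub (Metric.mem_ball_self hρ)))

theorem volume_ball_le {ρ : ℝ} (hρ : 0 < ρ) (z : EuclideanSpace ℝ (Fin n)) :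
    volume (Metric.ball z ρ) ≤ ENNReal.ofReal (3 * ρ) ^ n :=
  (measure_mono (ball_subset_gridCube hρ z)).trans_eq (volume_gridCube _ _)

theorem map_sub_smul (z : EuclideanSpace ℝ (Fin n)) {c : ℝ} (hc : c ≠ 0) :
    Measure.map (fun h : EuclideanSpace ℝ (Fin n) => z - c • h) volume =
      ENNReal.ofReal |(c ^ n)⁻¹| • (volume : Measure (EuclideanSpace ℝ (Fin n))) := by
  have h1 := Measure.map_addHaar_smul (volume : Measure (EuclideanSpace ℝ (Fin n))) hc
  have h2 : (fun h : EuclideanSpace ℝ (Fin n) => z - c • h) = (fun y => z - y) ∘ (c • ·) := rfl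
  have h3 : Measure.map (fun y => z - y) volume =
      (volume : Measure (EuclideanSpace ℝ (Fin n))) :=
    (Measure.measurePreserving_sub_left _ z).map_eq
  rw [h2, ← Measure.map_map (by fun_prop) (by fun_prop), h1, Measure.map_smul, h3]
  simp

theorem quasiMeasurePreserving_sub_smul (z : EuclideanSpace ℝ (Fin n)) {c : ℝ} (hc : c ≠ 0) :
    Measure.QuasiMeasurePreserving (fun h : EuclideanSpace ℝ (Fin n) => z - c • h) :=
  ⟨by fun_prop, by
    rw [map_sub_smul z hc]
    exact Measure.smul_absolutelyContinuous⟩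

theorem setLIntegral_ball_comp_sub_smul {W : EuclideanSpace ℝ (Fin n) → ℝ≥0∞}
    (hW : Measurable W) (z : EuclideanSpace ℝ (Fin n)) {c : ℝ} (hc : 0 < c) (ρ : ℝ) :
    ∫⁻ h in Metric.ball 0 ρ, W (z - c • h) =
      ENNReal.ofReal (c ^ n)⁻¹ * ∫⁻ x in Metric.ball z (c * ρ), W x := by
  have hpre : (fun h : EuclideanSpace ℝ (Fin n) => z - c • h) ⁻¹' Metric.ball z (c * ρ) =
      Metric.ball 0 ρ := by
    ext h
    simp [norm_smul, abs_of_pos hc, hc]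
  rw [← hpre, ← setLIntegral_map measurableSet_ball hW (by fun_prop), map_sub_smul z hc.ne',
    Measure.restrict_smul, lintegral_smul_measure, abs_of_pos (by positivity), smul_eq_mul]

/-- The measure `|h|^{-(n+a)} dh` on the complement of the ball of radius `r`. -/
def tailMeasure (n : ℕ) (a r : ℝ) : Measure (EuclideanSpace ℝ (Fin n)) :=
  (volume.restrict (Metric.ball 0 r)ᶜ).withDensity
    fun h => ENNReal.ofReal (1 / ‖h‖ ^ ((n : ℝ) + a))

instance (n : ℕ) (a r : ℝ) : SFinite (tailMeasure n a r) := by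
  unfold tailMeasure; infer_instance

theorem lintegral_tailMeasure (a r : ℝ) (φ : EuclideanSpace ℝ (Fin n) → ℝ≥0∞) :
    ∫⁻ h, φ h ∂tailMeasure n a r =
      ∫⁻ h in (Metric.ball 0 r)ᶜ, ENNReal.ofReal (1 / ‖h‖ ^ ((n : ℝ) + a)) * φ h := by
  unfold tailMeasure
  rw [lintegral_withDensity_eq_lintegral_mul_non_measurable _ (by fun_prop)
    (ae_of_all _ fun h => ENNReal.ofReal_lt_top)]
  rfl

theorem lintegral_tailMeasure_le_tsum {a r : ℝ} (ha : 0 < a) (hr : 0 < r)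
    {φ : EuclideanSpace ℝ (Fin n) → ℝ≥0∞} (hφ : Measurable φ) :
    ∫⁻ h, φ h ∂tailMeasure n a r ≤
      ∑' i : ℕ, ENNReal.ofReal (1 / (2 ^ i * r) ^ ((n : ℝ) + a)) *
        ∫⁻ h in Metric.ball 0 (2 ^ (i + 1) * r), φ h := by
  rw [lintegral_tailMeasure, ← lintegral_indicator measurableSet_ball.compl]
  have h1 : ∀ i : ℕ, ENNReal.ofReal (1 / (2 ^ i * r) ^ ((n : ℝ) + a)) *
        ∫⁻ h in Metric.ball 0 (2 ^ (i + 1) * r), φ h =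
      ∫⁻ h, (Metric.ball 0 (2 ^ (i + 1) * r)).indicator
        (fun h => ENNReal.ofReal (1 / (2 ^ i * r) ^ ((n : ℝ) + a)) * φ h) h := fun i => by
    rw [lintegral_indicator measurableSet_ball, lintegral_const_mul _ hφ]
  simp_rw [h1]
  rw [← lintegral_tsum fun i =>
    ((hφ.const_mul _).indicator measurableSet_ball).aemeasurable]
  refine lintegral_mono fun h => ?_
  by_cases hh : h ∈ (Metric.ball (0 : EuclideanSpace ℝ (Fin n)) r)ᶜ
  · have hle : r ≤ ‖h‖ := by simpa using hh
    obtain ⟨i, hi1, hi2⟩ := exists_nat_pow_near ((one_le_div hr).2 hle) (one_lt_two (α := ℝ))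
    rw [le_div_iff₀ hr] at hi1
    rw [div_lt_iff₀ hr] at hi2
    refine le_trans ?_ (ENNReal.le_tsum i)
    rw [Set.indicator_of_mem hh, Set.indicator_of_mem (by simpa using hi2)]
    gcongr
  · rw [Set.indicator_of_notMem hh]
    exact zero_le

theorem lintegral_tailMeasure_le {a r : ℝ} (ha : 0 < a) (hr : 0 < r)
    {φ : EuclideanSpace ℝ (Fin n) → ℝ≥0∞} (hφ : Measurable φ) {M : ℝ≥0∞}
    (hM : ∀ i : ℕ, ∫⁻ h in Metric.ball 0 (2 ^ (i + 1) * r), φ h ≤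
      ENNReal.ofReal (3 * (2 ^ (i + 1) * r)) ^ n * M) :
    ∫⁻ h, φ h ∂tailMeasure n a r ≤
      ENNReal.ofReal (6 ^ n * r ^ (-a) * (1 - 2 ^ (-a))⁻¹) * M := by
  have h2 : (2 : ℝ) ^ (-a) < 1 := Real.rpow_lt_one_of_one_lt_of_neg one_lt_two (by linarith)
  have h20 : (0 : ℝ) ≤ 2 ^ (-a) := by positivity
  have hterm : ∀ i : ℕ, ENNReal.ofReal (1 / (2 ^ i * r) ^ ((n : ℝ) + a)) *
        ∫⁻ h in Metric.ball 0 (2 ^ (i + 1) * r), φ h ≤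
      ENNReal.ofReal (6 ^ n * r ^ (-a) * (2 ^ (-a)) ^ i) * M := fun i => by
    have hpos : (0 : ℝ) < 2 ^ i * r := by positivity
    refine (mul_le_mul_right (hM i) _).trans_eq ?_
    rw [← mul_assoc, ← ENNReal.ofReal_pow (by positivity), ← ENNReal.ofReal_mul (by positivity)]
    congr 2
    rw [Real.rpow_add hpos, Real.rpow_natCast, Real.mul_rpow (by positivity) hr.le,
      Real.rpow_neg hr.le, Real.rpow_neg zero_le_two, ← Real.rpow_natCast_mul zero_le_two,
      inv_pow, ← Real.rpow_mul_natCast zero_le_two, mul_comm (i : ℝ) a]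
    have h3 : (3 * (2 ^ (i + 1) * r)) ^ n = 6 ^ n * (2 ^ i * r) ^ n := by
      rw [← mul_pow]; ring
    rw [h3]
    field_simp
  refine (lintegral_tailMeasure_le_tsum ha hr hφ).trans
    ((ENNReal.tsum_le_tsum hterm).trans_eq ?_)
  rw [ENNReal.tsum_mul_right, ← ENNReal.ofReal_tsum_of_nonneg (fun i => by positivity)
    ((summable_geometric_of_lt_one h20 h2).mul_left _), tsum_mul_left,
    tsum_geometric_of_lt_one h20 h2]

theorem inv_one_sub_two_rpow_neg_le {s b : ℝ} (hs0 : 0 < s) (hs1 : s ≤ 1) (hb : 1 ≤ b) :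
    (1 - (2 : ℝ) ^ (-(s * b)))⁻¹ ≤ 2 / s := by
  have h1 : (2 : ℝ) ^ (-(s * b)) ≤ 2 ^ (-s) :=
    Real.rpow_le_rpow_of_exponent_le one_le_two (by nlinarith)
  have h2 : (2 : ℝ) ^ (-s) ≤ 1 - s / 2 := by
    have := rpow_one_add_le_one_add_mul_self (s := -1 / 2) (by norm_num) hs0.le hs1
    rw [Real.rpow_neg zero_le_two, ← Real.inv_rpow zero_le_two]
    norm_num at this ⊢
    linarith
  rw [← inv_div s 2]
  exact inv_anti₀ (by positivity) (by linarith)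

theorem measurable_kdiff (k : ℕ) {f : EuclideanSpace ℝ (Fin n) → ℝ} (hf : Measurable f) :
    Measurable fun y : EuclideanSpace ℝ (Fin n) × EuclideanSpace ℝ (Fin n) =>
      kdiff k f y.2 y.1 := by
  unfold kdiff
  simp_rw [← Nat.cast_smul_eq_nsmul ℝ]
  fun_prop

theorem enorm_kdiff_rpow_le (k : ℕ) (f : EuclideanSpace ℝ (Fin n) → ℝ)
    (h x : EuclideanSpace ℝ (Fin n)) {p : ℝ} (hp : 1 ≤ p) :
    ‖kdiff k f h x‖ₑ ^ p ≤ ((k + 1 : ℕ) : ℝ≥0∞) ^ (p - 1) *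
      ∑ j ∈ Finset.range (k + 1), ((2 : ℝ≥0∞) ^ k) ^ p * ‖f (x + (j : ℝ) • h)‖ₑ ^ p := by
  have h1 : ‖kdiff k f h x‖ₑ ≤
      ∑ j ∈ Finset.range (k + 1), (2 : ℝ≥0∞) ^ k * ‖f (x + (j : ℝ) • h)‖ₑ := by
    refine (enorm_sum_le _ _).trans (Finset.sum_le_sum fun j _ => ?_)
    rw [enorm_mul, enorm_mul, enorm_pow, enorm_neg, enorm_one, one_pow, one_mul,
      Nat.cast_smul_eq_nsmul]
    gcongr
    rw [← ofReal_norm, Real.norm_natCast, ENNReal.ofReal_natCast]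
    exact_mod_cast Nat.choose_le_two_pow k j
  refine (ENNReal.rpow_le_rpow h1 (by linarith)).trans
    ((ENNReal.rpow_sum_le_const_mul_sum_rpow _ _ hp).trans_eq ?_)
  simp_rw [ENNReal.mul_rpow_of_nonneg _ _ (zero_le_one.trans hp), Finset.card_range]

theorem lintegral_rpow_rpow_le {α : Type*} [MeasurableSpace α] {ν : Measure α} {g : α → ℝ}
    (hg : AEStronglyMeasurable g ν) {p q : ℝ} (hq : 0 < q) (hqp : q ≤ p) :
    (∫⁻ h, ‖g h‖ₑ ^ q ∂ν) ^ (p / q) ≤ ν univ ^ (p / q - 1) * ∫⁻ h, ‖g h‖ₑ ^ p ∂ν := by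
  have hp : 0 < p := hq.trans_le hqp
  have := ENNReal.rpow_le_rpow (eLpNorm'_le_eLpNorm'_mul_rpow_measure_univ hq hqp hg) hp.le
  rw [eLpNorm'_eq_lintegral_enorm, eLpNorm'_eq_lintegral_enorm, ← ENNReal.rpow_mul,
    ENNReal.mul_rpow_of_nonneg _ _ hp.le, ← ENNReal.rpow_mul, ← ENNReal.rpow_mul,
    one_div_mul_cancel hp.ne', ENNReal.rpow_one] at this
  have he : p / q - 1 = (1 / q - 1 / p) * p := by field_simp
  rw [he, div_eq_mul_one_div p q, mul_comm p, mul_comm (ν univ ^ _)]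
  exact this

theorem lintegral_lintegral_shift_eq {f : EuclideanSpace ℝ (Fin n) → ℝ} (hf : Measurable f)
    {W : EuclideanSpace ℝ (Fin n) → ℝ≥0∞} (hW : Measurable W)
    (ν : Measure (EuclideanSpace ℝ (Fin n))) [SFinite ν] (p c : ℝ) :
    ∫⁻ x, (∫⁻ h, ‖f (x + c • h)‖ₑ ^ p ∂ν) * W x =
      ∫⁻ z, ‖f z‖ₑ ^ p * ∫⁻ h, W (z - c • h) ∂ν := by
  calc ∫⁻ x, (∫⁻ h, ‖f (x + c • h)‖ₑ ^ p ∂ν) * W x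
      = ∫⁻ x, ∫⁻ h, ‖f (x + c • h)‖ₑ ^ p * W x ∂ν := by
        refine lintegral_congr fun x => ?_
        rw [lintegral_mul_const _ (by fun_prop)]
    _ = ∫⁻ h, ∫⁻ x, ‖f (x + c • h)‖ₑ ^ p * W x ∂volume ∂ν :=
        lintegral_lintegral_swap (by unfold Function.uncurry; fun_prop)
    _ = ∫⁻ h, ∫⁻ z, ‖f z‖ₑ ^ p * W (z - c • h) ∂volume ∂ν := by
        refine lintegral_congr fun h => ?_
        rw [← lintegral_add_right_eq_self (fun z => ‖f z‖ₑ ^ p * W (z - c • h)) (c • h)]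
        simp
    _ = ∫⁻ z, ∫⁻ h, ‖f z‖ₑ ^ p * W (z - c • h) ∂ν :=
        lintegral_lintegral_swap (by unfold Function.uncurry; fun_prop)
    _ = _ := by
        refine lintegral_congr fun z => ?_
        rw [lintegral_const_mul _ (by fun_prop)]

theorem lintegral_kdiff_le (k : ℕ) {f : EuclideanSpace ℝ (Fin n) → ℝ} (hf : Measurable f)
    {W : EuclideanSpace ℝ (Fin n) → ℝ≥0∞} (hW : Measurable W)
    (ν : Measure (EuclideanSpace ℝ (Fin n))) [SFinite ν] {p q : ℝ} (hp : 1 ≤ p) (hq : 0 < q)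
    (hqp : q ≤ p) {B : ℝ≥0∞}
    (hB : ∀ j : ℕ, ∀ᵐ z, ∫⁻ h, W (z - (j : ℝ) • h) ∂ν ≤ B * W z) :
    ∫⁻ x, (∫⁻ h, ‖kdiff k f h x‖ₑ ^ q ∂ν) ^ (p / q) * W x ≤
      ν univ ^ (p / q - 1) * (((k + 1 : ℕ) : ℝ≥0∞) ^ p * ((2 : ℝ≥0∞) ^ k) ^ p *
        (B * ∫⁻ x, ‖f x‖ₑ ^ p * W x)) := by
  have hkd := measurable_kdiff k hf
  set D : ℝ≥0∞ := ((k + 1 : ℕ) : ℝ≥0∞) ^ (p - 1) with hD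
  set T : ℝ≥0∞ := ((2 : ℝ≥0∞) ^ k) ^ p
  set V := ν univ ^ (p / q - 1)
  have hpt : ∀ x, (∫⁻ h, ‖kdiff k f h x‖ₑ ^ q ∂ν) ^ (p / q) * W x ≤
      V * (D * ∑ j ∈ Finset.range (k + 1),
        T * ((∫⁻ h, ‖f (x + (j : ℝ) • h)‖ₑ ^ p ∂ν) * W x)) := fun x => by
    have hmx : Measurable fun h => kdiff k f h x := hkd.comp measurable_prodMk_left
    have h1 : ∫⁻ h, ‖kdiff k f h x‖ₑ ^ p ∂ν ≤
        D * ∑ j ∈ Finset.range (k + 1), T * ∫⁻ h, ‖f (x + (j : ℝ) • h)‖ₑ ^ p ∂ν := by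
      refine (lintegral_mono fun h => enorm_kdiff_rpow_le k f h x hp).trans_eq ?_
      rw [lintegral_const_mul _ (by fun_prop), lintegral_finsetSum _ (by fun_prop)]
      congr 1
      refine Finset.sum_congr rfl fun j _ => ?_
      rw [lintegral_const_mul _ (by fun_prop)]
    calc _ ≤ (V * (D * ∑ j ∈ Finset.range (k + 1),
            T * ∫⁻ h, ‖f (x + (j : ℝ) • h)‖ₑ ^ p ∂ν)) * W x := by
          gcongr
          exact (lintegral_rpow_rpow_le hmx.aestronglyMeasurable hq hqp).trans (by gcongr)
      _ = _ := by
          rw [mul_assoc, mul_assoc, Finset.sum_mul]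
          simp_rw [mul_assoc]
  have hin : ∀ j : ℕ, Measurable fun x => ∫⁻ h, ‖f (x + (j : ℝ) • h)‖ₑ ^ p ∂ν := fun j =>
    Measurable.lintegral_prod_right' (f := fun y : EuclideanSpace ℝ (Fin n) ×
      EuclideanSpace ℝ (Fin n) => ‖f (y.1 + (j : ℝ) • y.2)‖ₑ ^ p) (by fun_prop)
  refine (lintegral_mono hpt).trans ?_
  rw [lintegral_const_mul _ (by fun_prop), lintegral_const_mul _ (by fun_prop),
    lintegral_finsetSum _ (by fun_prop)]
  gcongr V * ?_
  have hj : ∀ j ∈ Finset.range (k + 1),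
      ∫⁻ x, T * ((∫⁻ h, ‖f (x + (j : ℝ) • h)‖ₑ ^ p ∂ν) * W x) ≤
        T * (B * ∫⁻ x, ‖f x‖ₑ ^ p * W x) := fun j _ => by
    rw [lintegral_const_mul _ (by fun_prop), lintegral_lintegral_shift_eq hf hW,
      ← lintegral_const_mul B (by fun_prop)]
    gcongr T * ?_
    refine lintegral_mono_ae ?_
    filter_upwards [hB j] with z hz
    calc _ ≤ ‖f z‖ₑ ^ p * (B * W z) := by gcongr
      _ = _ := by ring
  refine (mul_le_mul_right (Finset.sum_le_sum hj) D).trans_eq ?_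
  rw [Finset.sum_const, Finset.card_range, nsmul_eq_mul, ← mul_assoc, ← mul_assoc]
  congr 2
  have h0 : ((k + 1 : ℕ) : ℝ≥0∞) ≠ 0 := by simp
  rw [hD, ENNReal.rpow_sub _ _ h0 (ENNReal.natCast_ne_top _), ENNReal.rpow_one,
    ENNReal.div_mul_cancel h0 (ENNReal.natCast_ne_top _)]

theorem tailMeasure_univ_le {a r : ℝ} (ha : 0 < a) (hr : 0 < r) :
    tailMeasure n a r univ ≤ ENNReal.ofReal (6 ^ n * r ^ (-a) * (1 - 2 ^ (-a))⁻¹) := by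
  have := lintegral_tailMeasure_le (n := n) ha hr (φ := fun _ => 1) measurable_const (M := 1)
    fun i => by
      rw [setLIntegral_one, mul_one]
      exact volume_ball_le (by positivity) 0
  simpa using this

theorem ae_lintegral_tailMeasure_comp_le {a r A : ℝ} (ha : 0 < a) (hr : 0 < r) (hA : 1 ≤ A)
    {W : EuclideanSpace ℝ (Fin n) → ℝ≥0∞} (hW : Measurable W)
    (hA1 : ∀ ρ : ℝ, 0 < ρ → ∀ᵐ z, ∫⁻ x in Metric.ball z ρ, W x ≤
      ENNReal.ofReal A * ENNReal.ofReal (3 * ρ) ^ n * W z) (j : ℕ) :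
    ∀ᵐ z, ∫⁻ h, W (z - (j : ℝ) • h) ∂tailMeasure n a r ≤
      ENNReal.ofReal (6 ^ n * r ^ (-a) * (1 - 2 ^ (-a))⁻¹) * (ENNReal.ofReal A * W z) := by
  rcases Nat.eq_zero_or_pos j with rfl | hj
  · refine ae_of_all _ fun z => ?_
    simp only [Nat.cast_zero, zero_smul, sub_zero, lintegral_const]
    rw [mul_comm]
    gcongr
    · exact tailMeasure_univ_le ha hr
    · exact le_mul_of_one_le_left zero_le (by simpa using hA)
  · have hj' : (0 : ℝ) < j := by exact_mod_cast hj
    have hall := ae_all_iff.2 fun i : ℕ => hA1 (j * (2 ^ (i + 1) * r)) (by positivity)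
    filter_upwards [hall] with z hz
    refine lintegral_tailMeasure_le ha hr (by fun_prop) fun i => ?_
    rw [setLIntegral_ball_comp_sub_smul hW z hj']
    refine (mul_le_mul_right (hz i) _).trans_eq ?_
    have h3 : ENNReal.ofReal ((j : ℝ) ^ n)⁻¹ * ENNReal.ofReal (3 * (j * (2 ^ (i + 1) * r))) ^ n =
        ENNReal.ofReal (3 * (2 ^ (i + 1) * r)) ^ n := by
      rw [← ENNReal.ofReal_pow (by positivity), ← ENNReal.ofReal_pow (by positivity),
        ← ENNReal.ofReal_mul (by positivity)]
      congr 1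
      rw [mul_left_comm, mul_pow]
      field_simp
    rw [← h3]
    ring

theorem ae_kdiff_eq (k : ℕ) {f g : EuclideanSpace ℝ (Fin n) → ℝ} (hfg : f =ᵐ[volume] g) :
    ∀ᵐ x, ∀ᵐ h, kdiff k f h x = kdiff k g h x := by
  filter_upwards [hfg] with x hx
  have hj : ∀ j : ℕ, ∀ᵐ h : EuclideanSpace ℝ (Fin n), f (x + j • h) = g (x + j • h) := by
    intro j
    rcases Nat.eq_zero_or_pos j with rfl | hj
    · simpa using hx
    · have hj' : (-j : ℝ) ≠ 0 := by simpa using hj.ne'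
      filter_upwards [(quasiMeasurePreserving_sub_smul x hj').ae hfg] with h hh
      simpa [Nat.cast_smul_eq_nsmul] using hh
  filter_upwards [ae_all_iff.2 hj] with h hh
  simp [kdiff, hh]

theorem enorm_setIntegral_kdiff_le (k : ℕ) (g : EuclideanSpace ℝ (Fin n) → ℝ) {q : ℝ}
    (hq : 0 < q) (a r : ℝ) (x : EuclideanSpace ℝ (Fin n)) :
    ‖∫ h in (Metric.ball (0 : EuclideanSpace ℝ (Fin n)) r)ᶜ,
      |kdiff k g h x| ^ q / ‖h‖ ^ ((n : ℝ) + a)‖ₑ ≤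
        ∫⁻ h, ‖kdiff k g h x‖ₑ ^ q ∂tailMeasure n a r := by
  refine (enorm_integral_le_lintegral_enorm _).trans_eq ?_
  rw [lintegral_tailMeasure]
  refine lintegral_congr fun h => ?_
  rw [div_eq_mul_one_div, mul_comm, enorm_mul, Real.enorm_rpow_of_nonneg (abs_nonneg _) hq.le,
    Real.enorm_abs, Real.enorm_eq_ofReal (by positivity)]

theorem IsAp.integral_kdiff_le (k : ℕ) {p q a r : ℝ} (ha : 0 < a) (hr : 0 < r) (hp : 1 ≤ p)
    (hq : 1 ≤ q) (hqp : q ≤ p) {ω : EuclideanSpace ℝ (Fin n) → ℝ} (hω : IsA1 ω)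
    (hA : 1 ≤ A1const ω) {f : EuclideanSpace ℝ (Fin n) → ℝ}
    (hf : AEStronglyMeasurable f volume) (hfi : Integrable (fun x => |f x| ^ p * ω x))
    {b : ℝ} (hb0 : 0 < b) (hb : 6 ^ n * r ^ (-a) * (1 - 2 ^ (-a))⁻¹ ≤ b) :
    ∫ x, (∫ h in (Metric.ball (0 : EuclideanSpace ℝ (Fin n)) r)ᶜ,
        |kdiff k f h x| ^ q / ‖h‖ ^ ((n : ℝ) + a)) ^ (p / q) * ω x ≤
      b ^ (p / q - 1) * ((k + 1) ^ p * (2 ^ k) ^ p *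
        (b * A1const ω * ∫ x, |f x| ^ p * ω x)) := by
  have hp0 : 0 < p := by linarith
  have hq0 : 0 < q := by linarith
  set A := A1const ω
  obtain ⟨g, hg, hfg⟩ : ∃ g : EuclideanSpace ℝ (Fin n) → ℝ, Measurable g ∧ f =ᵐ[volume] g :=
    ⟨hf.mk f, hf.stronglyMeasurable_mk.measurable, hf.ae_eq_mk⟩
  obtain ⟨W, hW, hωW⟩ : ∃ W : EuclideanSpace ℝ (Fin n) → ℝ≥0∞, Measurable W ∧
      (fun x => ENNReal.ofReal (ω x)) =ᵐ[volume] W := by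
    have : AEMeasurable (fun x => ENNReal.ofReal (ω x)) :=
      hω.2.1.aestronglyMeasurable.aemeasurable.ennreal_ofReal
    exact ⟨this.mk _, this.measurable_mk, this.ae_eq_mk⟩
  have hA1 : ∀ ρ : ℝ, 0 < ρ → ∀ᵐ z, ∫⁻ x in Metric.ball z ρ, W x ≤
      ENNReal.ofReal A * ENNReal.ofReal (3 * ρ) ^ n * W z := fun ρ hρ => by
    filter_upwards [hω.ae_setLIntegral_ball_le hρ, hωW] with z hz hzW
    rw [← lintegral_congr_ae (ae_restrict_of_ae hωW), ← hzW]
    exact hz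
  have hB : ∀ j : ℕ, ∀ᵐ z, ∫⁻ h, W (z - (j : ℝ) • h) ∂tailMeasure n a r ≤
      ENNReal.ofReal (b * A) * W z := fun j => by
    filter_upwards [ae_lintegral_tailMeasure_comp_le ha hr hA hW hA1 j] with z hz
    refine hz.trans ?_
    rw [ENNReal.ofReal_mul hb0.le, mul_assoc (ENNReal.ofReal b)]
    gcongr
  have hν : tailMeasure n a r univ ≤ ENNReal.ofReal b :=
    (tailMeasure_univ_le ha hr).trans (ENNReal.ofReal_le_ofReal hb)
  have hI : ∫⁻ x, ‖g x‖ₑ ^ p * W x = ENNReal.ofReal (∫ x, |f x| ^ p * ω x) := by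
    rw [ofReal_integral_eq_lintegral_ofReal hfi
      (ae_of_all _ fun x => mul_nonneg (by positivity) (hω.1 x))]
    refine lintegral_congr_ae ?_
    filter_upwards [hfg, hωW] with x hx hxW
    rw [← hx, ← hxW, ENNReal.ofReal_mul (by positivity),
      ← Real.enorm_eq_ofReal (by positivity : 0 ≤ |f x| ^ p),
      Real.enorm_rpow_of_nonneg (abs_nonneg _) hp0.le, Real.enorm_abs]
  have hI0 : 0 ≤ ∫ x, |f x| ^ p * ω x :=
    integral_nonneg fun x => mul_nonneg (by positivity) (hω.1 x)
  have hA0 : 0 ≤ A := by linarith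
  rw [← ENNReal.ofReal_le_ofReal_iff (by positivity)]
  refine (Real.ofReal_le_enorm _).trans ((enorm_integral_le_lintegral_enorm _).trans ?_)
  calc _ ≤ ∫⁻ x, (∫⁻ h, ‖kdiff k g h x‖ₑ ^ q ∂tailMeasure n a r) ^ (p / q) * W x := by
        refine lintegral_mono_ae ?_
        filter_upwards [ae_kdiff_eq k hfg, hωW] with x hx hxW
        have hin : ∫ h in (Metric.ball (0 : EuclideanSpace ℝ (Fin n)) r)ᶜ,
              |kdiff k f h x| ^ q / ‖h‖ ^ ((n : ℝ) + a) =
            ∫ h in (Metric.ball (0 : EuclideanSpace ℝ (Fin n)) r)ᶜ,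
              |kdiff k g h x| ^ q / ‖h‖ ^ ((n : ℝ) + a) := by
          refine integral_congr_ae (ae_restrict_of_ae ?_)
          filter_upwards [hx] with h hh
          rw [hh]
        rw [hin, enorm_mul, Real.enorm_rpow_of_nonneg
          (integral_nonneg fun h => by positivity) (by positivity),
          Real.enorm_eq_ofReal (hω.1 x), hxW]
        gcongr
        exact enorm_setIntegral_kdiff_le k g hq0 a r x
    _ ≤ _ := lintegral_kdiff_le k hg hW _ hp hq0 hqp hB
    _ ≤ ENNReal.ofReal b ^ (p / q - 1) * (((k + 1 : ℕ) : ℝ≥0∞) ^ p * ((2 : ℝ≥0∞) ^ k) ^ p *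
        (ENNReal.ofReal (b * A) * ENNReal.ofReal (∫ x, |f x| ^ p * ω x))) := by
        rw [hI]
        gcongr
        rw [sub_nonneg, one_le_div hq0]
        exact hqp
    _ = _ := by
        have h1 : ((k + 1 : ℕ) : ℝ≥0∞) = ENNReal.ofReal ((k : ℝ) + 1) := by
          rw [← ENNReal.ofReal_natCast]; push_cast; rfl
        have h2 : (2 : ℝ≥0∞) ^ k = ENNReal.ofReal (2 ^ k) := by
          rw [ENNReal.ofReal_pow zero_le_two]; simp
        rw [h1, h2, ENNReal.ofReal_rpow_of_pos hb0, ENNReal.ofReal_rpow_of_pos (by positivity),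
          ENNReal.ofReal_rpow_of_pos (by positivity), ← ENNReal.ofReal_mul (by positivity),
          ← ENNReal.ofReal_mul (by positivity), ← ENNReal.ofReal_mul (by positivity),
          ← ENNReal.ofReal_mul (by positivity)]

end Paper

/-- Lemma 4.3: weighted bound for the non-local part of the Gagliardo seminorm. -/
theorem statement17 (n k : ℕ) (hn : 0 < n) (hk : 0 < k) (p q : ℝ)
    (hp : 1 ≤ p) (hq1 : 1 ≤ q) (hqp : q ≤ p) :
    ∃ C : ℝ, 0 < C ∧ ∀ ω : EuclideanSpace ℝ (Fin n) → ℝ, IsA1 ω →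
      ∀ s ∈ Set.Ioo (0 : ℝ) 1, ∀ r : ℝ, 0 < r →
      ∀ f : EuclideanSpace ℝ (Fin n) → ℝ, AEStronglyMeasurable f volume →
        Integrable (fun x => |f x| ^ p * ω x) →
        s ^ (1 / q) *
            (∫ x, (∫ h in (Metric.ball (0 : EuclideanSpace ℝ (Fin n)) r)ᶜ,
                |kdiff k f h x| ^ q / ‖h‖ ^ ((n : ℝ) + s * k * q)) ^ (p / q) * ω x) ^ (1 / p) ≤
          C * A1const ω ^ (2 / p) * r ^ (-(s * (k : ℝ))) *
            (∫ x, |f x| ^ p * ω x) ^ (1 / p) := by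
  refine ⟨(2 * 6 ^ n) ^ (1 / q) * ((k + 1) * 2 ^ k), by positivity, ?_⟩
  intro ω hω s hs r hr f hf hfi
  have hp0 : 0 < p := by linarith
  have hq0 : 0 < q := by linarith
  have hs0 : 0 < s := hs.1
  have hk1 : (1 : ℝ) ≤ k := by exact_mod_cast hk
  have hA0 := A1const_nonneg ω
  have hI0 : 0 ≤ ∫ x, |f x| ^ p * ω x :=
    integral_nonneg fun x => mul_nonneg (by positivity) (hω.1 x)
  rcases lt_or_ge (A1const ω) 1 with hlt | hA
  · have hJ : ∫ x, (∫ h in (Metric.ball (0 : EuclideanSpace ℝ (Fin n)) r)ᶜ,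
        |kdiff k f h x| ^ q / ‖h‖ ^ ((n : ℝ) + s * k * q)) ^ (p / q) * ω x = 0 := by
      refine integral_eq_zero_of_ae ?_
      filter_upwards [hω.ae_eq_zero_of_A1const_lt_one hlt] with x hx
      simp [hx]
    rw [hJ, Real.zero_rpow (by positivity), mul_zero]
    positivity
  have ha : 0 < s * k * q := by positivity
  have hb : 6 ^ n * r ^ (-(s * k * q)) * (1 - (2 : ℝ) ^ (-(s * k * q)))⁻¹ ≤
      6 ^ n * r ^ (-(s * k * q)) * (2 / s) := by
    gcongr
    rw [mul_assoc]
    exact inv_one_sub_two_rpow_neg_le hs0 hs.2.le (by nlinarith)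
  have hmain := hω.integral_kdiff_le k ha hr hp hq1 hqp hA hf hfi (by positivity) hb
  set b : ℝ := 6 ^ n * r ^ (-(s * k * q)) * (2 / s) with hbdef
  set I := ∫ x, |f x| ^ p * ω x
  set A := A1const ω
  have hb0 : 0 < b := by positivity
  have hK : b ^ (p / q - 1) * ((k + 1) ^ p * (2 ^ k) ^ p * (b * A * I)) =
      b ^ (p / q) * ((k + 1) * 2 ^ k : ℝ) ^ p * A * I := by
    rw [Real.rpow_sub_one hb0.ne', Real.mul_rpow (x := (k : ℝ) + 1) (by positivity) (by positivity)]
    field_simp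
  have hsb : s ^ (1 / q) * b ^ (1 / q) = (2 * 6 ^ n) ^ (1 / q) * r ^ (-(s * k)) := by
    have : s * b = 2 * 6 ^ n * r ^ (-(s * k * q)) := by rw [hbdef]; field_simp
    rw [← Real.mul_rpow hs0.le hb0.le, this, Real.mul_rpow (by positivity) (by positivity),
      ← Real.rpow_mul hr.le]
    congr 2
    field_simp
  have hroot : (b ^ (p / q) * ((k + 1) * 2 ^ k : ℝ) ^ p * A * I) ^ (1 / p) =
      b ^ (1 / q) * ((k + 1) * 2 ^ k) * A ^ (1 / p) * I ^ (1 / p) := by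
    rw [Real.mul_rpow (by positivity) hI0, Real.mul_rpow (by positivity) hA0,
      Real.mul_rpow (by positivity) (by positivity), ← Real.rpow_mul hb0.le,
      ← Real.rpow_mul (by positivity), mul_one_div_cancel hp0.ne', Real.rpow_one]
    congr 4
    field_simp
  have hApow : A ^ (1 / p) ≤ A ^ (2 / p) :=
    Real.rpow_le_rpow_of_exponent_le hA (by gcongr; norm_num)
  calc _ ≤ s ^ (1 / q) * (b ^ (p / q) * ((k + 1) * 2 ^ k : ℝ) ^ p * A * I) ^ (1 / p) := by
        refine mul_le_mul_of_nonneg_left (Real.rpow_le_rpow ?_ (hmain.trans_eq hK)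
          (by positivity)) (by positivity)
        refine integral_nonneg fun x => mul_nonneg (Real.rpow_nonneg ?_ _) (hω.1 x)
        exact integral_nonneg fun h => by positivity
    _ = (s ^ (1 / q) * b ^ (1 / q)) * ((k + 1) * 2 ^ k) * A ^ (1 / p) * I ^ (1 / p) := by
        rw [hroot]; ring
    _ ≤ (s ^ (1 / q) * b ^ (1 / q)) * ((k + 1) * 2 ^ k) * A ^ (2 / p) * I ^ (1 / p) := by
        gcongr
    _ = _ := by rw [hsb]; ring

end
end
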